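/- arXiv:2110.03483 — 8 statements merged into one kernel-verified Lean document; each statement's English description precedes it below -/
import Mathlib

section
/- Every k-extendible graph is (k-1)-extendible. That is, if G is a k-extendible graph with k ≥ 1, then G is also (k-1)-extendible (where for k-1 = 0, 0-extendibility means that G is connected, has at least 2 vertices, and has a perfect matching). -/
/-- A graph `G` is `k`-extendible if it has at least `2k+2` vertices, is connected,
has a perfect matching, and every matching of size `k` extends to a perfect matching. -/
def SimpleGraph.IsKExtendible {V : Type*} (G : SimpleGraph V) (k : ℕ) : Prop :=
  2 * k + 2 ≤ Nat.card V ∧ G.Connected ∧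
    (∃ P : G.Subgraph, P.IsPerfectMatching) ∧
    ∀ M : G.Subgraph, M.IsMatching → M.edgeSet.ncard = k →
      ∃ P : G.Subgraph, P.IsPerfectMatching ∧ M ≤ P

def EdgeMatch {V : Type*} (G : SimpleGraph V) (S : Set (Sym2 V)) : Prop :=
  S ⊆ G.edgeSet ∧ ∀ e ∈ S, ∀ f ∈ S, ∀ v, v ∈ e → v ∈ f → e = f

theorem EdgeMatch.exists_subgraph {V : Type*} {G : SimpleGraph V} {S : Set (Sym2 V)}
    (h : EdgeMatch G S) : ∃ M : G.Subgraph, M.IsMatching ∧ M.edgeSet = S := by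
  refine ⟨{ verts := {v | ∃ w, s(v, w) ∈ S}
            Adj := fun v w => s(v, w) ∈ S
            adj_sub := fun {v w} hvw => by simpa using h.1 hvw
            edge_vert := fun {v w} hvw => ⟨w, hvw⟩
            symm := ⟨fun v w hvw => by rw [Sym2.eq_swap]; exact hvw⟩ }, ?_, ?_⟩
  · rintro v ⟨w, hw⟩
    refine ⟨w, hw, fun y hy => ?_⟩
    have := h.2 _ hy _ hw v (by simp) (by simp)
    exact Sym2.congr_right.1 this
  · ext e
    induction e with
    | _ x y => simp

theorem EdgeMatch.of_isMatching {V : Type*} {G : SimpleGraph V} {M : G.Subgraph}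
    (h : M.IsMatching) : EdgeMatch G M.edgeSet := by
  refine ⟨M.edgeSet_subset, ?_⟩
  intro e he f hf v hve hvf
  obtain ⟨x, rfl⟩ := hve
  obtain ⟨y, rfl⟩ := hvf
  have : x = y := h.eq_of_adj_left (by simpa using he) (by simpa using hf)
  rw [this]

theorem EdgeMatch.mono {V : Type*} {G : SimpleGraph V} {S T : Set (Sym2 V)}
    (h : EdgeMatch G T) (hs : S ⊆ T) : EdgeMatch G S :=
  ⟨hs.trans h.1, fun e he f hf => h.2 e (hs he) f (hs hf)⟩

theorem perfect_card {V : Type*} [Fintype V] {G : SimpleGraph V} {P : G.Subgraph}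
    (h : P.IsPerfectMatching) : Nat.card V ≤ 2 * P.edgeSet.ncard := by
  classical
  have h1 : (Finset.univ : Finset V) ⊆ P.edgeSet.toFinset.biUnion (fun e => e.toFinset) := by
    intro v _
    obtain ⟨w, hw, _⟩ := h.1 (h.2 v)
    simp only [Finset.mem_biUnion]
    exact ⟨s(v, w), by simpa using hw, by simp⟩
  have h2 := Finset.card_le_card h1
  have h3 := Finset.card_biUnion_le_card_mul P.edgeSet.toFinset
    (fun e => e.toFinset) 2 (fun e _ => by
      rw [Sym2.card_toFinset]; split_ifs <;> omega)
  rw [Set.ncard_eq_toFinset_card', Nat.card_eq_fintype_card]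
  rw [Finset.card_univ] at h2
  omega

theorem extend_aux {V : Type*} [Fintype V] [DecidableEq V]
    (G : SimpleGraph V) (k : ℕ) (h : G.IsKExtendible k) (S : Finset (Sym2 V)) :
    EdgeMatch G (S : Set (Sym2 V)) → S.card ≤ k →
      ∃ P : G.Subgraph, P.IsPerfectMatching ∧ (S : Set (Sym2 V)) ⊆ P.edgeSet := by
  classical
  obtain ⟨hc, -, ⟨P0, hP0⟩, hext⟩ := h
  induction S using Finset.induction_on with
  | empty => exact fun _ _ => ⟨P0, hP0, by simp⟩
  | insert e S he ih =>
    intro hS hcard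
    have hcard' := Finset.card_insert_of_notMem he
    obtain ⟨P, hP, hSP⟩ := ih (hS.mono (by simp)) (by omega)
    by_cases heP : e ∈ P.edgeSet
    · exact ⟨P, hP, by
        intro f hf
        rcases Finset.mem_insert.1 (Finset.mem_coe.1 hf) with rfl | hf
        · exact heP
        · exact hSP hf⟩
    have hPm := EdgeMatch.of_isMatching hP.1
    have hPc := perfect_card hP
    rw [Set.ncard_eq_toFinset_card'] at hPc
    set E := P.edgeSet.toFinset with hE
    have hmem : ∀ f, f ∈ E ↔ f ∈ P.edgeSet := fun f => by simp [hE]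
    have hdisj : ∀ f ∈ S, ∀ v, v ∈ e → v ∉ f := by
      intro f hf v hv hvf
      have := hS.2 e (by simp) f (by simp [hf]) v hv hvf
      exact he (this ▸ hf)
    set R := E.filter (fun f => ∃ v, v ∈ e ∧ v ∈ f) with hR
    have hRc : R.card ≤ 2 := by
      have h1 : R ⊆ e.toFinset.biUnion (fun v => E.filter (fun f => v ∈ f)) := by
        intro f hf
        simp only [hR, Finset.mem_filter] at hf
        obtain ⟨hf, v, hv, hvf⟩ := hf
        simp only [Finset.mem_biUnion, Finset.mem_filter]
        exact ⟨v, by simpa using hv, hf, hvf⟩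
      have h2 := Finset.card_le_card h1
      have h3 := Finset.card_biUnion_le_card_mul e.toFinset
        (fun v => E.filter (fun f => v ∈ f)) 1 (fun v _ => by
          rw [Finset.card_le_one]
          intro f hf g hg
          rw [Finset.mem_filter] at hf hg
          exact hPm.2 f ((hmem f).1 hf.1) g ((hmem g).1 hg.1) v hf.2 hg.2)
      have h4 : e.toFinset.card ≤ 2 := by
        rw [Sym2.card_toFinset]; split_ifs <;> omega
      omega
    have hsd := Finset.le_card_sdiff R E
    have heQ : e ∉ E \ R := fun hh => heP ((hmem e).1 (Finset.mem_sdiff.1 hh).1)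
    have hQc := Finset.card_insert_of_notMem heQ
    have hdQ : ∀ f ∈ E \ R, ∀ v, v ∈ e → v ∉ f := by
      intro f hf v hv hvf
      rw [Finset.mem_sdiff] at hf
      exact hf.2 (Finset.mem_filter.2 ⟨hf.1, v, hv, hvf⟩)
    have hQ : EdgeMatch G ((insert e (E \ R) : Finset _) : Set (Sym2 V)) := by
      constructor
      · intro f hf
        rcases Finset.mem_insert.1 (Finset.mem_coe.1 hf) with rfl | hf
        · exact hS.1 (by simp)
        · exact hPm.1 ((hmem f).1 (Finset.mem_sdiff.1 hf).1)
      · intro f hf g hg v hvf hvg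
        rcases Finset.mem_insert.1 (Finset.mem_coe.1 hf) with rfl | hf <;>
        rcases Finset.mem_insert.1 (Finset.mem_coe.1 hg) with rfl | hg
        · rfl
        · exact absurd hvg (hdQ g hg v hvf)
        · exact absurd hvf (hdQ f hf v hvg)
        · exact hPm.2 f ((hmem f).1 (Finset.mem_sdiff.1 hf).1) g
            ((hmem g).1 (Finset.mem_sdiff.1 hg).1) v hvf hvg
    have hsub : insert e S ⊆ insert e (E \ R) := by
      apply Finset.insert_subset_insert
      intro f hf
      refine Finset.mem_sdiff.2 ⟨(hmem f).2 (hSP hf), fun hh => ?_⟩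
      obtain ⟨_, v, hv, hvf⟩ := Finset.mem_filter.1 hh
      exact hdisj f hf v hv hvf
    obtain ⟨T, hST, hTQ, hTc⟩ := Finset.exists_subsuperset_card_eq hsub hcard (by omega)
    obtain ⟨M, hM, hMT⟩ := (hQ.mono (Finset.coe_subset.2 hTQ)).exists_subgraph
    obtain ⟨P', hP', hMP⟩ := hext M hM (by rw [hMT, Set.ncard_coe_finset, hTc])
    refine ⟨P', hP', (Finset.coe_subset.2 hST).trans ?_⟩
    rw [← hMT]
    exact SimpleGraph.Subgraph.edgeSet_mono hMP

/-- Every `k`-extendible graph (`k ≥ 1`) is `(k-1)`-extendible. -/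
theorem kExtendible_implies_pred_extendible {V : Type*} [Fintype V]
    (G : SimpleGraph V) (k : ℕ) (hk : 1 ≤ k)
    (h : G.IsKExtendible k) : G.IsKExtendible (k - 1) := by
  classical
  refine ⟨by have := h.1; omega, h.2.1, h.2.2.1, fun M hM hMc => ?_⟩
  rw [Set.ncard_eq_toFinset_card'] at hMc
  obtain ⟨P, hP, hsub⟩ := extend_aux G k h M.edgeSet.toFinset
    (by simpa using EdgeMatch.of_isMatching hM) (by omega)
  rw [Set.coe_toFinset] at hsub
  refine ⟨P, hP, fun v _ => hP.2 v, fun v w hvw => ?_⟩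
  exact hsub (show s(v, w) ∈ M.edgeSet from hvw)
end

section
/- Every 1-extendible graph is 2-connected. -/
namespace OneExt

open SimpleGraph

variable {V : Type*}

lemma exists_nbr (G : SimpleGraph V) (hG : G.Connected) (v : V) (S : Set V) (hv : v ∉ S)
    (a : V) (ha : a ∈ S) (hS : ∀ x ∈ S, ∀ y, G.Adj x y → y ∈ S ∨ y = v) :
    ∃ x ∈ S, G.Adj v x := by
  obtain ⟨p⟩ := hG.preconnected a v
  obtain ⟨d, -, h1, h2⟩ := p.exists_boundary_dart S ha hv
  rcases hS _ h1 _ d.adj with h | h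
  · exact absurd h h2
  · exact ⟨d.fst, h1, h ▸ d.adj.symm⟩

lemma even_of_closed [Finite V] (G : SimpleGraph V) (P : G.Subgraph) (hP : P.IsPerfectMatching)
    (S : Set V) (hS : ∀ x ∈ S, ∀ y, P.Adj x y → y ∈ S) : Even S.ncard := by
  classical
  have := Fintype.ofFinite V
  have hM : (P.induce S).IsMatching := by
    intro x hx
    have hx' : x ∈ S := hx
    obtain ⟨y, hy, hu⟩ := hP.1 (hP.2 x)
    exact ⟨y, ⟨hx', hS x hx' y hy, hy⟩, fun z hz => hu z hz.2.2⟩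
  have := hM.even_card
  rw [Set.ncard_eq_toFinset_card']
  convert this using 2
  ext z
  simp

lemma exists_pm (G : SimpleGraph V) (h : G.IsKExtendible 1) {x y : V} (hxy : G.Adj x y) :
    ∃ P : G.Subgraph, P.IsPerfectMatching ∧ P.Adj x y := by
  obtain ⟨P, hP, hle⟩ := h.2.2.2 (G.subgraphOfAdj hxy) (Subgraph.IsMatching.subgraphOfAdj hxy)
    (by simp)
  exact ⟨P, hP, hle.2 (by simp)⟩

end OneExt

/-- Every 1-extendible graph is 2-connected: it has more than 2 vertices and
remains connected after deleting any single vertex. -/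
theorem oneExtendible_twoConnected {V : Type*} [Fintype V]
    (G : SimpleGraph V) (h : G.IsKExtendible 1) :
    2 < Fintype.card V ∧ ∀ v : V, (G.induce ({v}ᶜ : Set V)).Connected := by
  have hc : 2 < Fintype.card V := by
    have := h.1
    rw [Nat.card_eq_fintype_card] at this
    omega
  refine ⟨hc, fun v => ?_⟩
  have hne : Nonempty ({v}ᶜ : Set V) := by
    have : Nontrivial V := Fintype.one_lt_card_iff_nontrivial.1 (by omega)
    obtain ⟨w, hw⟩ := exists_ne v
    exact ⟨⟨w, hw⟩⟩
  refine ⟨fun a b => ?_⟩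
  by_contra hab
  let A : Set V := {x | ∃ hx : x ∈ ({v}ᶜ : Set V), (G.induce ({v}ᶜ : Set V)).Reachable a ⟨x, hx⟩}
  have hvA : v ∉ A := fun ⟨hx, _⟩ => hx rfl
  have hA : ∀ x ∈ A, ∀ y, G.Adj x y → y ∈ A ∨ y = v := by
    rintro x ⟨hx, hr⟩ y hxy
    by_cases hy : y = v
    · exact Or.inr hy
    · refine Or.inl ⟨hy, hr.trans (SimpleGraph.Adj.reachable ?_)⟩
      simpa using hxy
  have haA : (a : V) ∈ A := ⟨a.2, SimpleGraph.Reachable.refl _⟩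
  have hbA : (b : V) ∉ A := fun ⟨_, hr⟩ => hab hr
  obtain ⟨x, hxA, hvx⟩ := OneExt.exists_nbr G h.2.1 v A hvA a haA hA
  obtain ⟨y, hyB, hvy⟩ := OneExt.exists_nbr G h.2.1 v {z | z ∉ A ∧ z ≠ v} (fun hz => hz.2 rfl) b
    ⟨hbA, b.2⟩ (by
      rintro z ⟨hzA, hzv⟩ w hzw
      by_cases hw : w = v
      · exact Or.inr hw
      · refine Or.inl ⟨fun hwA => ?_, hw⟩
        rcases hA w hwA z hzw.symm with h1 | h1
        · exact hzA h1
        · exact hzv h1)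
  obtain ⟨P, hP, hPx⟩ := OneExt.exists_pm G h hvx
  obtain ⟨Q, hQ, hQy⟩ := OneExt.exists_pm G h hvy
  have e1 : Even A.ncard := by
    refine OneExt.even_of_closed G Q hQ A fun z hz w hzw => ?_
    rcases hA z hz w hzw.adj_sub with h1 | h1
    · exact h1
    · subst h1
      have := (hQ.1 (hQ.2 w)).unique hzw.symm hQy
      exact absurd (this ▸ hz) hyB.1
  have e2 : Even (insert v A).ncard := by
    refine OneExt.even_of_closed G P hP _ fun z hz w hzw => ?_
    rcases hz with rfl | hz
    · have := (hP.1 (hP.2 z)).unique hzw hPx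
      exact Or.inr (this ▸ hxA)
    · exact (hA z hz w hzw.adj_sub).symm
  rw [Set.ncard_insert_of_notMem hvA] at e2
  exact (Nat.even_add_one.1 e2) e1
end

section
/- Let G be a k-extendible graph with k ≥ 2. Then for every edge uv of G, the graph G - {u,v} obtained by deleting the two endpoints u and v (and all incident edges) is (k-1)-extendible. -/
theorem ext_of_edges {V : Type*} [Fintype V] (G : SimpleGraph V) (k : ℕ)
    (h : G.IsKExtendible k) (E : Set (Sym2 V)) (hE : E ⊆ G.edgeSet)
    (hm : ∀ x y z, s(x,y) ∈ E → s(x,z) ∈ E → y = z) (hc : E.ncard = k) :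
    ∃ p : V → V, (∀ x, G.Adj x (p x)) ∧ (∀ x, p (p x) = x) ∧
      ∀ x y, s(x,y) ∈ E → p x = y := by
  obtain ⟨-, -, -, h⟩ := h
  let M : G.Subgraph :=
    { verts := {x | ∃ y, s(x,y) ∈ E}
      Adj := fun x y => s(x,y) ∈ E
      adj_sub := fun {x y} hxy => hE hxy
      edge_vert := fun {x y} hxy => ⟨y, hxy⟩
      symm := ⟨fun x y hxy => by rwa [Sym2.eq_swap]⟩ }
  have hM : M.IsMatching := by
    rintro x ⟨y, hy⟩
    exact ⟨y, hy, fun z hz => hm x z y hz hy⟩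
  have hME : M.edgeSet = E := by
    ext e
    induction e using Sym2.ind with
    | _ x y => exact SimpleGraph.Subgraph.mem_edgeSet
  obtain ⟨P, hP, hle⟩ := h M hM (by rw [hME, hc])
  rw [SimpleGraph.Subgraph.isPerfectMatching_iff] at hP
  choose p hp hu using hP
  refine ⟨p, fun x => (hp x).adj_sub, fun x => (hu _ _ (hp x).symm).symm, ?_⟩
  intro x y hxy
  exact (hu x y (hle.2 hxy)).symm

theorem ext_small {V : Type*} [Fintype V] (G : SimpleGraph V) (k : ℕ)
    (h : G.IsKExtendible k) (p : V → V) (hpa : ∀ x, G.Adj x (p x)) (hpp : ∀ x, p (p x) = x)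
    (N : Set (Sym2 V)) (hN : N ⊆ G.edgeSet)
    (hm : ∀ x y z, s(x,y) ∈ N → s(x,z) ∈ N → y = z) (hc : N.ncard ≤ k)
    (T : Set V) (hT : ∀ x y, s(x,y) ∈ N → x ∈ T)
    (hcT : ((fun x => s(x, p x)) '' T).ncard ≤ N.ncard + 1) :
    ∃ p : V → V, (∀ x, G.Adj x (p x)) ∧ (∀ x, p (p x) = x) ∧
      ∀ x y, s(x,y) ∈ N → p x = y := by
  classical
  set F : Set (Sym2 V) := (fun x => s(x, p x)) '' T with hF
  set R : Set (Sym2 V) := Set.range (fun x => s(x, p x)) with hR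
  have hRp : ∀ x y, s(x,y) ∈ R → y = p x := by
    rintro x y ⟨z, hz⟩
    simp only [Sym2.eq_iff] at hz
    rcases hz with ⟨rfl, rfl⟩ | ⟨rfl, rfl⟩
    · rfl
    · exact (hpp _).symm
  have hRF : ∀ x y, s(x,y) ∈ R \ F → x ∉ T := by
    rintro x y ⟨hxy, hn⟩ hx
    apply hn
    rw [hRp x y hxy]
    exact ⟨x, hx, rfl⟩
  have hRcard : k + 1 ≤ R.ncard := by
    have h1 : Fintype.card V ≤ 2 * R.ncard := by
      have := Finset.card_le_mul_card_image (f := fun x => s(x, p x)) (Finset.univ : Finset V) 2 ?_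
      · rwa [← Set.ncard_coe_finset (Finset.image _ _), Finset.coe_image, Finset.coe_univ,
          Set.image_univ] at this
      · intro b hb
        obtain ⟨z, -, rfl⟩ := Finset.mem_image.1 hb
        refine (Finset.card_le_card (t := {z, p z}) ?_).trans Finset.card_le_two
        intro y hy
        simp only [Finset.mem_filter, Sym2.eq_iff] at hy
        simp only [Finset.mem_insert, Finset.mem_singleton]
        tauto
    have h2 := h.1
    rw [Nat.card_eq_fintype_card] at h2
    omega
  have hdisj : Disjoint N (R \ F) := by
    rw [Set.disjoint_left]
    intro e
    induction e using Sym2.ind with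
    | _ x y => exact fun he hr => hRF x y hr (hT x y he)
  have hbig : k ≤ (N ∪ (R \ F)).ncard := by
    rw [Set.ncard_union_eq hdisj]
    have := Set.ncard_le_ncard_sdiff_add_ncard R F
    omega
  obtain ⟨E, hNE, hEU, hEc⟩ := Set.exists_subsuperset_card_eq
    (Set.subset_union_left : N ⊆ N ∪ (R \ F)) hc hbig
  suffices hs : E ⊆ G.edgeSet ∧ (∀ x y z, s(x,y) ∈ E → s(x,z) ∈ E → y = z) by
    obtain ⟨q, h1, h2, h3⟩ := ext_of_edges G k h E hs.1 hs.2 hEc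
    exact ⟨q, h1, h2, fun x y hxy => h3 x y (hNE hxy)⟩
  constructor
  · intro e he
    rcases hEU he with he | ⟨⟨x, rfl⟩, -⟩
    · exact hN he
    · exact hpa x
  · intro x y z hy hz
    rcases hEU hy with hy | hy <;> rcases hEU hz with hz | hz
    · exact hm x y z hy hz
    · exact absurd (hT _ _ hy) (hRF _ _ hz)
    · exact absurd (hT _ _ hz) (hRF _ _ hy)
    · rw [hRp _ _ hy.1, hRp _ _ hz.1]

theorem ext_one {V : Type*} [Fintype V] (G : SimpleGraph V) (k : ℕ) (hk : 2 ≤ k)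
    (h : G.IsKExtendible k) (u v : V) (huv : G.Adj u v) :
    ∃ p : V → V, (∀ x, G.Adj x (p x)) ∧ (∀ x, p (p x) = x) ∧ p u = v := by
  obtain ⟨P, hP⟩ := h.2.2.1
  rw [SimpleGraph.Subgraph.isPerfectMatching_iff] at hP
  choose p hp hu using hP
  obtain ⟨q, h1, h2, h3⟩ := ext_small G k h p (fun x => (hp x).adj_sub)
    (fun x => (hu _ _ (hp x).symm).symm) {s(u,v)} (by simpa using huv)
    (by intro x y z; simp only [Set.mem_singleton_iff, Sym2.eq_iff]; grind)
    (by rw [Set.ncard_singleton]; omega) {u, v}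
    (by intro x y; simp only [Set.mem_singleton_iff, Sym2.eq_iff]; grind)
    (by rw [Set.ncard_singleton, Set.image_pair]; exact Set.ncard_insert_le _ _ |>.trans (by simp))
  exact ⟨q, h1, h2, h3 _ _ rfl⟩

theorem ext_two {V : Type*} [Fintype V] (G : SimpleGraph V) (k : ℕ) (hk : 2 ≤ k)
    (h : G.IsKExtendible k) (u v a b : V) (huv : G.Adj u v) (hua : G.Adj u a) (hvb : G.Adj v b)
    (hav : a ≠ v) (hbu : b ≠ u) (hab : a ≠ b) :
    ∃ p : V → V, (∀ x, G.Adj x (p x)) ∧ (∀ x, p (p x) = x) ∧ p u = a ∧ p v = b := by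
  obtain ⟨p, hp1, hp2, hp3⟩ := ext_one G k hk h u v huv
  have hne := huv.ne
  have hne1 := hua.ne
  have hne2 := hvb.ne
  have hN : ({s(u,a), s(v,b)} : Set (Sym2 V)).ncard = 2 := by
    apply Set.ncard_pair
    rw [Ne, Sym2.eq_iff]
    grind
  obtain ⟨q, h1, h2, h3⟩ := ext_small G k h p hp1 hp2 {s(u,a), s(v,b)}
    (by rintro e (rfl | rfl) <;> assumption)
    (by intro x y z; simp only [Set.mem_insert_iff, Set.mem_singleton_iff, Sym2.eq_iff]; grind)
    (by omega) {u, v, a, b}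
    (by intro x y; simp only [Set.mem_insert_iff, Set.mem_singleton_iff, Sym2.eq_iff]; grind)
    (by
      rw [hN]
      have hpv : p v = u := by rw [← hp3, hp2]
      have : ((fun x => s(x, p x)) '' {u, v, a, b}) ⊆ {s(u,v), s(a, p a), s(b, p b)} := by
        rintro _ ⟨x, (rfl | rfl | rfl | rfl), rfl⟩
        · simp [hp3]
        · simp [hpv, Sym2.eq_swap]
        · simp
        · simp
      refine (Set.ncard_le_ncard this (Set.toFinite _)).trans ?_
      have i1 := Set.ncard_insert_le s(u,v) {s(a, p a), s(b, p b)}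
      have i2 := Set.ncard_insert_le s(a,p a) {s(b, p b)}
      rw [Set.ncard_singleton] at i2
      omega)
  exact ⟨q, h1, h2, h3 _ _ (by simp), h3 _ _ (by simp)⟩

theorem even_of_invol {V : Type*} [Fintype V] (p : V → V) (hne : ∀ x, p x ≠ x)
    (hpp : ∀ x, p (p x) = x) (S : Finset V) (hS : ∀ x ∈ S, p x ∈ S) : Even S.card := by
  have : ∑ x ∈ S, (1 : ZMod 2) = 0 :=
    Finset.sum_involution (fun x _ => p x) (fun _ _ => by decide) (fun x _ _ => hne x)
      hS (fun x _ => hpp x)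
  rw [Finset.sum_const, nsmul_eq_mul, mul_one] at this
  exact (ZMod.natCast_eq_zero_iff_even).1 this

/-- no crossing -/
theorem no_cross {V : Type*} [Fintype V] (G : SimpleGraph V) (k : ℕ) (hk : 2 ≤ k)
    (h : G.IsKExtendible k) (u v a b : V) (huv : G.Adj u v) (A : Set V)
    (hu : u ∉ A) (hv : v ∉ A) (hA : ∀ x ∈ A, ∀ y, G.Adj x y → y ∈ A ∨ y = u ∨ y = v)
    (ha : a ∈ A) (hb : b ∉ A) (hbu : b ≠ u) (hua : G.Adj u a) (hvb : G.Adj v b) : False := by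
  classical
  obtain ⟨p, hp1, hp2, hp3⟩ := ext_one G k hk h u v huv
  obtain ⟨q, hq1, hq2, hq3, hq4⟩ := ext_two G k hk h u v a b huv hua hvb
    (by grind) hbu (by grind)
  have e1 := even_of_invol p (fun x => (hp1 x).ne') hp2 A.toFinset (by
    intro x hx
    rw [Set.mem_toFinset] at hx ⊢
    have := hA x hx _ (hp1 x)
    grind)
  have e2 := even_of_invol q (fun x => (hq1 x).ne') hq2 (A.toFinset.erase a) (by
    intro x hx
    rw [Finset.mem_erase, Set.mem_toFinset] at hx ⊢
    have := hA x hx.2 _ (hq1 x)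
    grind)
  have e3 := Finset.card_erase_add_one (s := A.toFinset) (a := a) (by simpa using ha)
  grind

theorem has_nbr {V : Type*} (G : SimpleGraph V) (hG : G.Connected) (u v : V) (A : Set V)
    (hu : u ∉ A) (hA : ∀ x ∈ A, ∀ y, G.Adj x y → y ∈ A ∨ y = u ∨ y = v)
    (hne : A.Nonempty) : (∃ a ∈ A, G.Adj u a) ∨ (∃ a ∈ A, G.Adj v a) := by
  obtain ⟨x, hx⟩ := hne
  obtain ⟨w⟩ := hG.preconnected x u
  obtain ⟨d, -, h1, h2⟩ := w.exists_boundary_dart A hx hu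
  have h3 := d.adj
  rcases hA _ h1 _ h3 with h4 | h4 | h4
  · exact absurd h4 h2
  · exact Or.inl ⟨_, h1, h4 ▸ h3.symm⟩
  · exact Or.inr ⟨_, h1, h4 ▸ h3.symm⟩

theorem conn_aux {V : Type*} [Fintype V] (G : SimpleGraph V) (k : ℕ) (hk : 2 ≤ k)
    (h : G.IsKExtendible k) (u v : V) (huv : G.Adj u v) (A B : Set V)
    (hne : A.Nonempty) (hneB : B.Nonempty)
    (hu : u ∉ A) (hv : v ∉ A) (huB : u ∉ B) (hvB : v ∉ B) (hAB : ∀ x ∈ A, x ∉ B)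
    (hA : ∀ x ∈ A, ∀ y, G.Adj x y → y ∈ A ∨ y = u ∨ y = v)
    (hB : ∀ x ∈ B, ∀ y, G.Adj x y → y ∈ B ∨ y = u ∨ y = v)
    (hall : ∀ x, x ∈ A ∨ x ∈ B ∨ x = u ∨ x = v) : False := by
  have c1 : ∀ a ∈ A, ∀ b ∈ B, G.Adj u a → G.Adj v b → False := fun a ha b hb h1 h2 =>
    no_cross G k hk h u v a b huv A hu hv hA ha (fun h => hAB b h hb) (by grind) h1 h2
  have c2 : ∀ a ∈ A, ∀ b ∈ B, G.Adj v a → G.Adj u b → False := fun a ha b hb h1 h2 =>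
    no_cross G k hk h v u a b huv.symm A hv hu (by grind) ha (fun h => hAB b h hb) (by grind) h1 h2
  have key : ∀ u v : V, (∃ a, G.Adj u a ∧ a ≠ v) → (∀ y, G.Adj v y → y = u) → False := by
    rintro u v ⟨a, ha, hav⟩ hy
    obtain ⟨p, hp1, hp2, hp3⟩ := ext_one G k hk h u a ha
    have := hy _ (hp1 v)
    have h2 := hp2 v
    rw [this, hp3] at h2
    exact hav h2
  rcases has_nbr G h.2.1 u v A hu hA hne with ⟨a, ha, h1⟩ | ⟨a, ha, h1⟩ <;>
    rcases has_nbr G h.2.1 u v B huB hB hneB with ⟨b, hb, h2⟩ | ⟨b, hb, h2⟩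
  · refine key u v ⟨a, h1, by grind⟩ fun y hy => ?_
    have := hy.ne
    rcases hall y with h3 | h3 | h3 | h3
    · exact (c2 y h3 b hb hy h2).elim
    · exact (c1 a ha y h3 h1 hy).elim
    · exact h3
    · exact absurd h3.symm this
  · exact c1 a ha b hb h1 h2
  · exact c2 a ha b hb h1 h2
  · refine key v u ⟨a, h1, by grind⟩ fun y hy => ?_
    have := hy.ne
    rcases hall y with h3 | h3 | h3 | h3
    · exact (c1 y h3 b hb hy h2).elim
    · exact (c2 a ha y h3 h1 hy).elim
    · exact absurd h3.symm this
    · exact h3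

theorem restrict_pm {V : Type*} (G : SimpleGraph V) (u v : V) (p : V → V)
    (h1 : ∀ x, G.Adj x (p x)) (h2 : ∀ x, p (p x) = x) (h3 : p u = v) :
    ∃ P : (G.induce ({u, v}ᶜ : Set V)).Subgraph, P.IsPerfectMatching ∧
      P.verts = Set.univ ∧ ∀ x y, P.Adj x y ↔ p x.1 = y.1 := by
  let P : (G.induce ({u, v}ᶜ : Set V)).Subgraph :=
    { verts := Set.univ
      Adj := fun x y => p x.1 = y.1
      adj_sub := fun {x y} hxy => by
        change G.Adj x.1 y.1
        rw [← hxy]; exact h1 _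
      edge_vert := fun _ => trivial
      symm := ⟨fun x y hxy => by rw [← hxy, h2]⟩ }
  refine ⟨P, ?_, rfl, fun _ _ => Iff.rfl⟩
  rw [SimpleGraph.Subgraph.isPerfectMatching_iff]
  rintro ⟨x, hx⟩
  have hx' : p x ∈ ({u, v}ᶜ : Set V) := by
    simp only [Set.mem_compl_iff, Set.mem_insert_iff, Set.mem_singleton_iff, not_or] at hx ⊢
    have := h2 x
    have := h2 u
    grind
  exact ⟨⟨p x, hx'⟩, rfl, fun y hy => Subtype.ext (Eq.symm hy)⟩

/-- If `G` is `k`-extendible with `k ≥ 2`, then for every edge `uv`,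
the graph `G - {u,v}` is `(k-1)`-extendible. -/
theorem deleteEdgeEnds_extendible {V : Type*} [Fintype V]
    (G : SimpleGraph V) (k : ℕ) (hk : 2 ≤ k) (h : G.IsKExtendible k)
    (u v : V) (huv : G.Adj u v) :
    (G.induce ({u, v}ᶜ : Set V)).IsKExtendible (k - 1) := by
  classical
  have hk1 := h.1
  have hcard : Nat.card ({u, v}ᶜ : Set V) + 2 = Nat.card V := by
    have := Set.ncard_add_ncard_compl ({u, v} : Set V)
    rw [Set.ncard_pair huv.ne] at this
    rw [Nat.card_coe_set_eq]
    omega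
  refine ⟨by omega, ?_, ?_, ?_⟩
  · have hne : Nonempty ({u, v}ᶜ : Set V) := by
      by_contra hcon
      rw [not_nonempty_iff] at hcon
      rw [Nat.card_of_isEmpty] at hcard
      omega
    refine { preconnected := ?_, nonempty := hne }
    intro x y
    by_contra hxy
    refine conn_aux G k hk h u v huv
      {z | ∃ hz : z ∈ ({u, v}ᶜ : Set V), (G.induce ({u, v}ᶜ : Set V)).Reachable x ⟨z, hz⟩}
      {z | ∃ hz : z ∈ ({u, v}ᶜ : Set V), ¬ (G.induce ({u, v}ᶜ : Set V)).Reachable x ⟨z, hz⟩}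
      ⟨x.1, x.2, SimpleGraph.Reachable.refl _⟩ ⟨y.1, y.2, hxy⟩ ?_ ?_ ?_ ?_ ?_ ?_ ?_ ?_
    · rintro ⟨hz, -⟩; simp at hz
    · rintro ⟨hz, -⟩; simp at hz
    · rintro ⟨hz, -⟩; simp at hz
    · rintro ⟨hz, -⟩; simp at hz
    · rintro z ⟨hz, h1⟩ ⟨hz', h2⟩; exact h2 h1
    · rintro z ⟨hz, h1⟩ w hw
      by_cases hwm : w ∈ ({u, v}ᶜ : Set V)
      · left
        refine ⟨hwm, h1.trans (SimpleGraph.Adj.reachable ?_)⟩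
        exact hw
      · right; simpa [or_iff_not_imp_left] using hwm
    · rintro z ⟨hz, h1⟩ w hw
      by_cases hwm : w ∈ ({u, v}ᶜ : Set V)
      · left
        refine ⟨hwm, fun h2 => h1 (h2.trans (SimpleGraph.Adj.reachable ?_))⟩
        exact hw.symm
      · right; simpa [or_iff_not_imp_left] using hwm
    · intro w
      by_cases hwm : w ∈ ({u, v}ᶜ : Set V)
      · by_cases hr : (G.induce ({u, v}ᶜ : Set V)).Reachable x ⟨w, hwm⟩
        · exact Or.inl ⟨hwm, hr⟩
        · exact Or.inr (Or.inl ⟨hwm, hr⟩)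
      · right; right; simpa [or_iff_not_imp_left] using hwm
  · obtain ⟨p, h1, h2, h3⟩ := ext_one G k hk h u v huv
    obtain ⟨P, hP, -⟩ := restrict_pm G u v p h1 h2 h3
    exact ⟨P, hP⟩
  · intro M hM hc
    set N : Set (Sym2 V) := Sym2.map Subtype.val '' M.edgeSet with hN
    have hNm : ∀ x y, s(x,y) ∈ N → ∃ hx hy, M.Adj ⟨x, hx⟩ ⟨y, hy⟩ := by
      rintro x y ⟨e, he, hxy⟩
      induction e using Sym2.ind with
      | _ a b =>
        rw [SimpleGraph.Subgraph.mem_edgeSet] at he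
        rw [Sym2.map_mk, Sym2.eq_iff] at hxy
        rcases hxy with ⟨rfl, rfl⟩ | ⟨rfl, rfl⟩
        · exact ⟨a.2, b.2, he⟩
        · exact ⟨b.2, a.2, he.symm⟩
    have hNc : N.ncard = k - 1 := by
      rw [hN, Set.ncard_image_of_injective _ (Sym2.map.injective Subtype.val_injective), hc]
    have hnot : s(u,v) ∉ N := by
      intro hh
      obtain ⟨hx, -⟩ := hNm _ _ hh
      simp at hx
    have hNuv : ∀ x y, s(x,y) ∈ N → x ≠ u ∧ x ≠ v := by
      intro x y hxy
      obtain ⟨hx, -⟩ := hNm _ _ hxy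
      simpa using hx
    have hne := huv.ne
    suffices hs : insert s(u,v) N ⊆ G.edgeSet ∧
        (∀ x y z, s(x,y) ∈ insert s(u,v) N → s(x,z) ∈ insert s(u,v) N → y = z) ∧
        (insert s(u,v) N).ncard = k by
      obtain ⟨p, h1, h2, h3⟩ := ext_of_edges G k h (insert s(u,v) N) hs.1 hs.2.1 hs.2.2
      obtain ⟨P, hP, hPv, hPa⟩ := restrict_pm G u v p h1 h2 (h3 _ _ (Set.mem_insert _ _))
      refine ⟨P, hP, ?_, ?_⟩
      · rw [hPv]; exact Set.subset_univ _
      · intro x y hxy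
        rw [hPa]
        exact h3 _ _ (Set.mem_insert_of_mem _ ⟨s(x,y), hxy, rfl⟩)
    refine ⟨?_, ?_, ?_⟩
    · intro e
      induction e using Sym2.ind with
      | _ x y =>
        rintro (he | he)
        · rw [he]; exact huv
        · obtain ⟨hx, hy, hxy⟩ := hNm _ _ he
          exact hxy.adj_sub
    · intro x y z hy hz
      rw [Set.mem_insert_iff, Sym2.eq_iff] at hy hz
      have a1 := hNuv x y
      have a2 := hNuv x z
      by_cases hyz : s(x,y) ∈ N ∧ s(x,z) ∈ N
      · obtain ⟨hx, hy, hxy⟩ := hNm _ _ hyz.1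
        obtain ⟨hx, hz, hxz⟩ := hNm _ _ hyz.2
        exact congrArg Subtype.val (hM.eq_of_adj_left hxy hxz)
      · grind
    · rw [Set.ncard_insert_of_notMem hnot, hNc]
      omega
end

section
/- If G is a k-extendible graph with k ≥ 1, then the minimum degree of G is at least k+1; that is, every vertex of G has at least k+1 neighbors. -/
namespace KExt

open Finset

variable {V : Type*} [Fintype V] [DecidableEq V]

def Inv (G : SimpleGraph V) (f : V → V) : Prop :=
  (∀ v, f (f v) = v) ∧ ∀ v, f v ≠ v → G.Adj v (f v)

def supp (f : V → V) : Finset V := univ.filter fun v => f v ≠ v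

def Q (G : SimpleGraph V) (W : Finset V) : Prop :=
  ∀ A ⊆ W, (∀ a ∈ A, ∀ b ∈ W, G.Adj a b → b ∈ A) → Even A.card

def Ext (G : SimpleGraph V) : ℕ → Finset V → Prop
  | 0, W => Q G W
  | k+1, W => Q G W ∧ ∀ x ∈ W, ∀ y ∈ W, G.Adj x y → Ext G k (W \ {x, y})

def Conn (G : SimpleGraph V) (W : Finset V) : Prop :=
  ∀ A ⊆ W, A.Nonempty → (∀ a ∈ A, ∀ b ∈ W, G.Adj a b → b ∈ A) → A = W

lemma Ext.q {G : SimpleGraph V} {k : ℕ} {W : Finset V} (h : Ext G k W) : Q G W := by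
  cases k with
  | zero => exact h
  | succ k => exact h.1

lemma Q.nbr {G : SimpleGraph V} {W : Finset V} (h : Q G W) {v : V} (hv : v ∈ W) :
    ∃ b ∈ W, G.Adj v b := by
  by_contra hc
  push Not at hc
  have := h {v} (by simpa using hv) (by
    intro a ha b hb hab
    rw [mem_singleton] at ha
    subst ha
    exact absurd hab (hc b hb))
  simp at this

lemma cross {G : SimpleGraph V} {k : ℕ} {W : Finset V} (h : Ext G (k+2) W)
    {x y : V} (hx : x ∈ W) (hy : y ∈ W) (hxy : G.Adj x y)
    {A : Finset V} (hA : A ⊆ W \ {x, y})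
    (hcl : ∀ a ∈ A, ∀ b ∈ W \ {x, y}, G.Adj a b → b ∈ A)
    {a z : V} (ha : a ∈ A) (hz : z ∈ W \ {x, y}) (hzA : z ∉ A) (h1 : G.Adj x a)
    (h2 : G.Adj y z) : False := by
  have e1 : Even A.card := (h.2 x hx y hy hxy).q A hA hcl
  have hne := hxy.ne
  have haW := hA ha
  simp only [mem_sdiff, mem_insert, mem_singleton, not_or] at haW hz
  have hza : z ≠ a := by rintro rfl; exact hzA ha
  have e2 := ((h.2 x hx a haW.1 h1).2 y (by simp; grind) z (by simp; grind) h2).q (A.erase a)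
    (by
      intro b hb
      have := hA (mem_of_mem_erase hb)
      simp only [mem_sdiff, mem_insert, mem_singleton, not_or, mem_erase] at this hb ⊢
      grind)
    (by
      intro b hb c hc hbc
      simp only [mem_sdiff, mem_insert, mem_singleton, not_or, mem_erase] at hc hb ⊢
      refine ⟨by tauto, hcl b hb.2 c ?_ hbc⟩
      simp; tauto)
  have := card_erase_add_one ha
  grind

lemma conn_step {G : SimpleGraph V} {k : ℕ} {W : Finset V} (h : Ext G (k+2) W)
    (hW : Conn G W) {x y : V} (hx : x ∈ W) (hy : y ∈ W) (hxy : G.Adj x y) :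
    Conn G (W \ {x, y}) := by
  intro A hA hne hcl
  by_contra hAW
  set B := (W \ {x, y}) \ A with hB
  have hBne : B.Nonempty := by
    rw [hB, sdiff_nonempty]
    intro hh
    exact hAW (subset_antisymm hA hh)
  have hBs : B ⊆ W \ {x, y} := sdiff_subset
  have hBcl : ∀ a ∈ B, ∀ b ∈ W \ {x, y}, G.Adj a b → b ∈ B := by
    intro a ha b hb hab
    rw [hB, mem_sdiff] at ha ⊢
    exact ⟨hb, fun hbA => ha.2 (hcl b hbA a ha.1 hab.symm)⟩
  have key : ∀ C ⊆ W \ {x, y}, C.Nonempty →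
      (∀ a ∈ C, ∀ b ∈ W \ {x, y}, G.Adj a b → b ∈ C) →
      ∃ a ∈ C, G.Adj x a ∨ G.Adj y a := by
    intro C hC hCne hCcl
    by_contra hcon
    push Not at hcon
    have := hW C (hC.trans sdiff_subset) hCne (by
      intro a ha b hb hab
      refine hCcl a ha b ?_ hab
      have := hcon a ha
      simp only [mem_sdiff, mem_insert, mem_singleton, not_or]
      refine ⟨hb, ?_, ?_⟩
      · rintro rfl; exact this.1 hab.symm
      · rintro rfl; exact this.2 hab.symm)
    have h3 := hC (this ▸ hx)
    simp at h3
  have hBm : ∀ b ∈ B, b ∈ W \ {x, y} ∧ b ∉ A := fun b hb => by simpa [hB] using hb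
  have c1 : ∀ a ∈ A, ∀ b ∈ B, G.Adj x a → G.Adj y b → False := fun a ha b hb h1 h2 =>
    cross h hx hy hxy hA hcl ha (hBm b hb).1 (hBm b hb).2 h1 h2
  have c2 : ∀ a ∈ A, ∀ b ∈ B, G.Adj y a → G.Adj x b → False := fun a ha b hb h1 h2 => by
    have hp : ({x, y} : Finset V) = {y, x} := pair_comm _ _
    refine cross h hy hx hxy.symm (hp ▸ hA) (hp ▸ hcl) ha (hp ▸ (hBm b hb).1) (hBm b hb).2 h1 h2
  have fin : ∀ u ∈ W, ∀ w ∈ W, G.Adj u w → ∀ b ∈ W, b ≠ w → G.Adj u b →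
      (∀ c ∈ W, G.Adj w c → c = u) → False := by
    intro u hu w hw huw b hb hbw hub hon
    obtain ⟨c, hc, hwc⟩ := (h.2 u hu b hb hub).q.nbr (v := w) (by
      have := huw.ne
      simp; grind)
    simp only [mem_sdiff, mem_insert, mem_singleton, not_or] at hc
    exact hc.2.1 (hon c hc.1 hwc)
  have mem : ∀ c ∈ W, c = x ∨ c = y ∨ c ∈ A ∨ c ∈ B := by
    intro c hc
    simp only [hB, mem_sdiff, mem_insert, mem_singleton]
    tauto
  obtain ⟨a, ha, hax⟩ := key A hA hne hcl
  obtain ⟨b, hb, hbx⟩ := key B hBs hBne hBcl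
  have hbW := hBs hb
  simp only [mem_sdiff, mem_insert, mem_singleton, not_or] at hbW
  rcases hax with hax | hay
  · have hbx : G.Adj x b := hbx.resolve_right (fun h' => c1 a ha b hb hax h')
    refine fin x hx y hy hxy b hbW.1 hbW.2.2 hbx ?_
    intro c hc hyc
    rcases mem c hc with rfl | rfl | h' | h'
    · rfl
    · exact absurd hyc G.irrefl
    · exact (c2 c h' b hb hyc hbx).elim
    · exact (c1 a ha c h' hax hyc).elim
  · have hby : G.Adj y b := hbx.resolve_left (fun h' => c2 a ha b hb hay h')
    refine fin y hy x hx hxy.symm b hbW.1 hbW.2.1 hby ?_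
    intro c hc hxc
    rcases mem c hc with rfl | rfl | h' | h'
    · exact absurd hxc G.irrefl
    · rfl
    · exact (c1 c h' b hb hxc hby).elim
    · exact (c2 a ha c h' hay hxc).elim

lemma main (G : SimpleGraph V) [DecidableRel G.Adj] (k : ℕ) : ∀ (W : Finset V),
    Ext G (k+1) W → Conn G W → 2 * (k+1) + 2 ≤ W.card → ∀ v ∈ W,
    k + 2 ≤ (W.filter (G.Adj v)).card := by
  induction k with
  | zero => ?_
  | succ k ih => ?_
  all_goals
    intro W h hW hc v hv
    have hxy : ∃ x ∈ W, ∃ y ∈ W, G.Adj v x ∧ G.Adj x y ∧ y ≠ v := by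
      by_contra hcon
      push Not at hcon
      have hS := hW (insert v (W.filter (G.Adj v))) (by
          intro a; simp only [mem_insert, mem_filter]; rintro (rfl | h) <;> tauto) (by simp) (by
          intro a ha b hb hab
          simp only [mem_insert, mem_filter] at ha ⊢
          rcases ha with rfl | ha
          · exact Or.inr ⟨hb, hab⟩
          · exact Or.inl (hcon a ha.1 b hb ha.2 hab))
      obtain ⟨x, hx, hvx⟩ := h.q.nbr hv
      have hq := (h.2 v hv x hx hvx).q
      have hcard : 0 < (W \ {v, x}).card := by
        have h1 := le_card_sdiff {v, x} W
        have h2 := card_le_two (a := v) (b := x)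
        omega
      obtain ⟨w, hw⟩ := card_pos.mp hcard
      obtain ⟨b, hb, hwb⟩ := hq.nbr hw
      simp only [mem_sdiff, mem_insert, mem_singleton, not_or] at hw hb
      have hw' := hw.1
      rw [← hS, mem_insert, mem_filter] at hw'
      rcases hw' with h' | h'
      · exact hw.2.1 h'
      · exact hb.2.1 (hcon w hw.1 b hb.1 h'.2 hwb)
    obtain ⟨x, hx, y, hy, hvx, hxy, hyv⟩ := hxy
    have hvW : v ∈ W \ {x, y} := by
      have := hvx.ne
      simp; grind
    have hlt : ((W \ {x, y}).filter (G.Adj v)).card < (W.filter (G.Adj v)).card := by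
      apply card_lt_card
      rw [ssubset_iff_of_subset (filter_subset_filter _ sdiff_subset)]
      exact ⟨x, by simp [hx, hvx], by simp⟩
    have hE := h.2 x hx y hy hxy
  · obtain ⟨b, hb, hvb⟩ := hE.q.nbr hvW
    have : 0 < ((W \ {x, y}).filter (G.Adj v)).card := card_pos.mpr ⟨b, by
      rw [mem_filter]; exact ⟨hb, hvb⟩⟩
    omega
  · have := ih _ hE (conn_step h hW hx hy hxy) (by
        have h1 := le_card_sdiff {x, y} W
        have h2 := card_le_two (a := x) (b := y)
        omega) v hvW
    omega

/-- Every matching (as an involution) of size `k` extends. -/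
def HK (G : SimpleGraph V) (k : ℕ) : Prop :=
  ∀ f, Inv G f → (supp f).card = 2 * k →
    ∃ p, Inv G p ∧ (∀ v, p v ≠ v) ∧ ∀ v, f v ≠ v → p v = f v

def add (f : V → V) (x y : V) : V → V := fun v => if v = x then y else if v = y then x else f v

lemma add_inv {G : SimpleGraph V} {f : V → V} (hf : Inv G f) {x y : V} (hx : f x = x)
    (hy : f y = y) (hxy : G.Adj x y) : Inv G (add f x y) := by
  have h1 := hf.1
  have h2 := hf.2
  have h3 := hxy.symm
  have h4 := hxy.ne
  constructor
  · intro v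
    unfold add
    grind
  · intro v
    unfold add
    grind

lemma add_supp {f : V → V} {x y : V} (hxy : x ≠ y) :
    supp (add f x y) = insert x (insert y (supp f)) := by
  ext v
  simp only [supp, add, mem_filter, mem_univ, true_and, mem_insert]
  grind

lemma add_card {f : V → V} {x y : V} (hx : f x = x)
    (hy : f y = y) (hxy : x ≠ y) : (supp (add f x y)).card = (supp f).card + 2 := by
  rw [add_supp hxy, card_insert_of_notMem, card_insert_of_notMem]
  · simp [supp, hy]
  · simp [supp, hx, hxy]

def exch (f : V → V) (s t : V) : V → V :=
  fun v => if v = s then t else if v = t then s else if v = f t then v else f v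

lemma no_indep {G : SimpleGraph V} {k : ℕ} (hH : HK G k) (hn : 2 * k + 2 ≤ Fintype.card V)
    {p : V → V} (hp : Inv G p) (hpf : ∀ v, p v ≠ v) (j : ℕ) : ∀ (m c : ℕ), m + j = k →
    ∀ f, Inv G f → (supp f).card = 2 * m →
    (univ.filter fun v => f v ≠ p v).card = c →
    (∀ x y, f x = x → f y = y → ¬ G.Adj x y) → False := by
  have fixed : ∀ f : V → V, ∀ m, m ≤ k → (supp f).card = 2 * m → ∃ s, f s = s := by
    intro f m hm hs
    by_contra hcon
    push Not at hcon
    have : supp f = univ := by ext v; simp [supp, hcon]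
    rw [this, card_univ] at hs
    omega
  induction j with
  | zero =>
    intro m c hm f hf hs _ hind
    obtain ⟨s, hs'⟩ := fixed f m (by omega) hs
    obtain ⟨q, hq, hqf, hqe⟩ := hH f hf (by rw [hs]; omega)
    refine hind s (q s) hs' ?_ (hq.2 s (hqf s))
    by_contra hcon
    have h1 := hqe (q s) hcon
    rw [hq.1] at h1
    have h2 := hf.1 (q s)
    rw [← h1, hs'] at h2
    exact hqf s h2.symm
  | succ j ih =>
    intro m c
    induction c using Nat.strong_induction_on with
    | _ c ihc =>
      intro hm f hf hs hc hind
      obtain ⟨s, hs'⟩ := fixed f m (by omega) hs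
      set t := p s with ht
      have hadj : G.Adj s t := hp.2 s (hpf s)
      have hft : f t ≠ t := fun h' => hind s t hs' h' hadj
      have hpt : p t = s := hp.1 s
      have hf1 := hf.1
      have hf2 := hf.2
      have hst := hadj.ne
      have hts := hadj.symm
      have hfts : f t ≠ s := by
        intro h'
        have := hf1 t
        rw [h', hs'] at this
        exact hst this
      have hg : Inv G (exch f s t) := by
        constructor
        · intro v; unfold exch; grind
        · intro v; unfold exch; grind
      have hgs : supp (exch f s t) = insert s ((supp f).erase (f t)) := by
        ext v
        simp only [supp, exch, mem_filter, mem_univ, true_and, mem_insert, mem_erase]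
        grind
      have hgc : (supp (exch f s t)).card = 2 * m := by
        rw [hgs, card_insert_of_notMem (by simp [supp, hs']), card_erase_add_one, hs]
        simp only [supp, mem_filter, mem_univ, true_and]
        grind
      by_cases hgi : ∀ x y, exch f s t x = x → exch f s t y = y → ¬ G.Adj x y
      · refine ihc _ ?_ hm (exch f s t) hg hgc rfl hgi
        rw [← hc]
        apply card_lt_card
        rw [ssubset_iff_of_subset]
        · refine ⟨s, ?_, ?_⟩
          · simp only [mem_filter, mem_univ, true_and]; grind
          · simp only [mem_filter, mem_univ, true_and, exch]; grind
        · intro v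
          simp only [mem_filter, mem_univ, true_and, exch]
          have := hp.1
          grind
      · push Not at hgi
        obtain ⟨x, y, hx, hy, hxy⟩ := hgi
        refine ih (m+1) _ (by omega) (add (exch f s t) x y) (add_inv hg hx hy hxy)
          (by rw [add_card hx hy hxy.ne, hgc]; ring) rfl ?_
        have hmem : x = f t ∨ y = f t := by
          by_contra hcon
          push Not at hcon
          refine hind x y ?_ ?_ hxy
          · unfold exch at hx; grind
          · unfold exch at hy; grind
        have hfix : ∀ u, add (exch f s t) x y u = u → f u = u := by
          intro u
          have := hxy.ne
          unfold add exch
          grind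
        intro u w hu hw
        exact hind u w (hfix u hu) (hfix w hw)

lemma extend {G : SimpleGraph V} {k : ℕ} (hH : HK G k) (hn : 2 * k + 2 ≤ Fintype.card V)
    {p : V → V} (hp : Inv G p) (hpf : ∀ v, p v ≠ v) (j : ℕ) : ∀ m, m + j = k →
    HK G m := by
  induction j with
  | zero => intro m hm; have : m = k := by omega
            subst this; exact hH
  | succ j ih =>
    intro m hm f hf hs
    by_cases hind : ∀ x y, f x = x → f y = y → ¬ G.Adj x y
    · exact (no_indep hH hn hp hpf (j+1) m _ hm f hf hs rfl hind).elim
    · push Not at hind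
      obtain ⟨x, y, hx, hy, hxy⟩ := hind
      obtain ⟨q, hq, hqf, hqe⟩ := ih (m+1) (by omega) (add f x y) (add_inv hf hx hy hxy)
        (by rw [add_card hx hy hxy.ne, hs]; ring)
      refine ⟨q, hq, hqf, fun v hv => ?_⟩
      have := hqe v
      unfold add at this
      grind

lemma even_of_inv (A : Finset V) (p : V → V) (h1 : ∀ v, p (p v) = v) (h2 : ∀ v, p v ≠ v)
    (h3 : ∀ a ∈ A, p a ∈ A) : Even A.card := by
  have : ∑ a ∈ A, (1 : ZMod 2) = 0 :=
    Finset.sum_involution (fun a _ => p a) (fun _ _ => by decide) (fun a _ _ => h2 a)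
      (fun a ha => h3 a ha) (fun a _ => h1 a)
  simp only [sum_const, nsmul_eq_mul, mul_one] at this
  exact (ZMod.natCast_eq_zero_iff_even).mp this

lemma ext_of {G : SimpleGraph V} {k : ℕ} (hH : ∀ m ≤ k, HK G m) (j : ℕ) : ∀ m, m + j ≤ k →
    ∀ f, Inv G f → (supp f).card = 2 * m → Ext G j (univ.filter fun v => f v = v) := by
  have hQ : ∀ m, m ≤ k → ∀ f, Inv G f → (supp f).card = 2 * m →
      Q G (univ.filter fun v => f v = v) := by
    intro m hm f hf hs A hA hcl
    obtain ⟨p, hp, hpf, hpe⟩ := hH m hm f hf hs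
    refine even_of_inv A p hp.1 hpf (fun a ha => hcl a ha _ ?_ (hp.2 a (hpf a)))
    have h0 := hA ha
    simp only [mem_filter, mem_univ, true_and] at h0 ⊢
    by_contra hcon
    have h1 := hpe (p a) hcon
    rw [hp.1] at h1
    have h2 := hf.1 (p a)
    rw [← h1, h0] at h2
    exact hpf a h2.symm
  induction j with
  | zero => intro m hm f hf hs; exact hQ m hm f hf hs
  | succ j ih =>
    intro m hm f hf hs
    refine ⟨hQ m (by omega) f hf hs, ?_⟩
    intro x hx y hy hxy
    simp only [mem_filter, mem_univ, true_and] at hx hy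
    have := ih (m+1) (by omega) (add f x y) (add_inv hf hx hy hxy)
      (by rw [add_card hx hy hxy.ne, hs]; ring)
    convert this using 1
    ext v
    have := hxy.ne
    simp only [mem_sdiff, mem_filter, mem_univ, true_and, mem_insert, mem_singleton, add]
    grind

lemma pm_inv {G : SimpleGraph V} {P : G.Subgraph} (hP : P.IsPerfectMatching) :
    ∃ p, Inv G p ∧ (∀ v, p v ≠ v) ∧ ∀ v w, P.Adj v w → p v = w := by
  rw [SimpleGraph.Subgraph.isPerfectMatching_iff] at hP
  choose p hp hu using hP
  refine ⟨p, ⟨fun v => ?_, fun v _ => (hp v).adj_sub⟩, fun v hv => ?_, fun v w h => (hu v w h).symm⟩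
  · exact (hu (p v) v (hp v).symm).symm
  · have := (hp v).adj_sub
    rw [hv] at this
    exact G.irrefl this

def sub {G : SimpleGraph V} {f : V → V} (hf : Inv G f) : G.Subgraph where
  verts := {v | f v ≠ v}
  Adj a b := f a = b ∧ a ≠ b
  adj_sub := by
    rintro a b ⟨rfl, h⟩
    exact hf.2 a h.symm
  edge_vert := by
    rintro a b ⟨rfl, h⟩
    exact h.symm
  symm := ⟨by
    rintro a b ⟨rfl, h⟩
    exact ⟨hf.1 a, h.symm⟩⟩

lemma sub_card {G : SimpleGraph V} {f : V → V} (hf : Inv G f) {k : ℕ}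
    (hk : (supp f).card = 2 * k) : (sub hf).edgeSet.ncard = k := by
  have h1 : (sub hf).edgeSet = ((supp f).image fun v => s(v, f v) : Finset (Sym2 V)) := by
    ext e
    induction e with
    | _ a b =>
      simp only [SimpleGraph.Subgraph.mem_edgeSet, coe_image, Set.mem_image, mem_coe, supp,
        mem_filter, mem_univ, true_and]
      constructor
      · rintro ⟨rfl, h⟩
        exact ⟨a, h.symm, rfl⟩
      · rintro ⟨v, hv, h⟩
        rw [Sym2.eq_iff] at h
        rcases h with ⟨rfl, rfl⟩ | ⟨rfl, rfl⟩
        · exact ⟨rfl, hv.symm⟩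
        · exact ⟨hf.1 _, hv⟩
  rw [h1, Set.ncard_coe_finset]
  have h2 := card_eq_sum_card_image (fun v => s(v, f v)) (supp f)
  have h3 : ∀ e ∈ (supp f).image (fun v => s(v, f v)),
      ((supp f).filter fun v => s(v, f v) = e).card = 2 := by
    intro e he
    rw [mem_image] at he
    obtain ⟨v, hv, rfl⟩ := he
    have hv' : f v ≠ v := by simpa [supp] using hv
    rw [← card_pair hv'.symm]
    congr 1
    ext w
    have := hf.1
    simp only [mem_filter, supp, mem_univ, true_and, Sym2.eq_iff, mem_insert, mem_singleton]
    grind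
  rw [sum_congr rfl h3] at h2
  simp at h2
  omega

lemma hk_of {G : SimpleGraph V} {k : ℕ} (h : G.IsKExtendible k) : HK G k := by
  intro f hf hs
  obtain ⟨P, hP, hle⟩ := h.2.2.2 (sub hf) (by
    intro v hv
    exact ⟨f v, ⟨rfl, Ne.symm hv⟩, fun w hw => hw.1.symm⟩) (sub_card hf hs)
  obtain ⟨p, hp, hpf, hpe⟩ := pm_inv hP
  exact ⟨p, hp, hpf, fun v hv => hpe v (f v) (hle.2 ⟨rfl, hv.symm⟩)⟩

lemma conn_of {G : SimpleGraph V} (h : G.Connected) : Conn G univ := by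
  intro A _ hne hcl
  obtain ⟨a, ha⟩ := hne
  ext b
  simp only [mem_univ, iff_true]
  obtain ⟨w⟩ := h.preconnected a b
  induction w with
  | nil => exact ha
  | cons hadj _ ih => exact ih (hcl _ ha _ (mem_univ _) hadj)

end KExt

/-- Every vertex of a `k`-extendible graph (`k ≥ 1`) has at least `k+1` neighbors. -/
theorem kExtendible_minDegree {V : Type*} [Fintype V]
    (G : SimpleGraph V) (k : ℕ) (hk : 1 ≤ k) (h : G.IsKExtendible k) :
    ∀ v : V, k + 1 ≤ (G.neighborSet v).ncard := by
  classical
  intro v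
  obtain ⟨k, rfl⟩ : ∃ j, k = j + 1 := ⟨k - 1, by omega⟩
  have hn : 2 * (k+1) + 2 ≤ Fintype.card V := by
    rw [← Nat.card_eq_fintype_card]; exact h.1
  obtain ⟨P, hP⟩ := h.2.2.1
  obtain ⟨p, hp, hpf, -⟩ := KExt.pm_inv hP
  have hH : ∀ m ≤ k + 1, KExt.HK G m := fun m hm =>
    KExt.extend (KExt.hk_of h) hn hp hpf (k + 1 - m) m (by omega)
  have hE := KExt.ext_of hH (k+1) 0 (by omega) id ⟨fun _ => rfl, fun _ h => absurd rfl h⟩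
    (by simp [KExt.supp])
  have := KExt.main G k Finset.univ (by simpa using hE) (KExt.conn_of h.2.1)
    (by simpa using hn) v (Finset.mem_univ v)
  have e : G.neighborSet v = ((Finset.univ.filter (G.Adj v) : Finset V) : Set V) := by
    ext w; simp
  rw [e, Set.ncard_coe_finset]
  exact this
end

section
/- Let G be a connected bipartite graph with bipartition (X,Y) that has a perfect matching, and suppose |V(G)| ≥ 2k+2. If for every subset A ⊆ X with 1 ≤ |A| ≤ |X| - k the neighborhood of A in G satisfies |N(A)| ≥ |A| + k, then G is k-extendible. -/
/-- The neighborhood of a vertex set `A`: all vertices adjacent to some vertex of `A`. -/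
def SimpleGraph.setNeighborhood {V : Type*} (G : SimpleGraph V) (A : Set V) : Set V :=
  {v | ∃ a ∈ A, G.Adj a v}

theorem ncard_side {V : Type*} (G : SimpleGraph V) (X Y : Set V) (hdisj : Disjoint X Y)
    (hbip : ∀ u v : V, G.Adj u v → (u ∈ X ∧ v ∈ Y) ∨ (u ∈ Y ∧ v ∈ X))
    (M : G.Subgraph) (hM : M.IsMatching) : (M.verts ∩ X).ncard = M.edgeSet.ncard := by
  classical
  have hd := Set.disjoint_left.1 hdisj
  have hex : ∀ v : V, ∃ w, v ∈ M.verts → M.Adj v w := by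
    intro v
    by_cases h : v ∈ M.verts
    · obtain ⟨w, hw, _⟩ := hM h
      exact ⟨w, fun _ => hw⟩
    · exact ⟨v, fun h' => absurd h' h⟩
  choose g hg using hex
  refine Set.ncard_congr (fun x _ => s(x, g x)) ?_ ?_ ?_
  · rintro a ⟨ha, _⟩
    exact hg a ha
  · rintro a b ⟨ha, hax⟩ ⟨hb, hbx⟩ h
    rcases Sym2.eq_iff.1 h with h | h
    · exact h.1
    · have h1 := hg a ha
      rw [h.2] at h1
      rcases hbip _ _ h1.adj_sub with h2 | h2
      · exact absurd h2.2 (hd hbx)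
      · exact absurd h2.1 (hd hax)
  · intro e
    induction e using Sym2.ind with
    | _ u v =>
    intro h
    have h : M.Adj u v := h
    rcases hbip _ _ h.adj_sub with h2 | h2
    · refine ⟨u, ⟨h.fst_mem, h2.1⟩, ?_⟩
      rw [hM.eq_of_adj_left (hg u h.fst_mem) h]
    · refine ⟨v, ⟨h.snd_mem, h2.2⟩, ?_⟩
      rw [hM.eq_of_adj_left (hg v h.snd_mem) h.symm, Sym2.eq_swap]

/-- Sufficiency: a connected bipartite graph with a perfect matching and at least
`2k+2` vertices satisfying the Hall-type condition `|N(A)| ≥ |A| + k` is `k`-extendible. -/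
theorem bipartite_hall_implies_kExtendible {V : Type*} [Fintype V]
    (G : SimpleGraph V) (k : ℕ) (X Y : Set V)
    (hcover : X ∪ Y = Set.univ) (hdisj : Disjoint X Y)
    (hbip : ∀ u v : V, G.Adj u v → (u ∈ X ∧ v ∈ Y) ∨ (u ∈ Y ∧ v ∈ X))
    (hconn : G.Connected) (hpm : ∃ P : G.Subgraph, P.IsPerfectMatching)
    (hcard : 2 * k + 2 ≤ Fintype.card V)
    (hHall : ∀ A : Set V, A ⊆ X → 1 ≤ A.ncard → A.ncard + k ≤ X.ncard →
      A.ncard + k ≤ (G.setNeighborhood A).ncard) :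
    G.IsKExtendible k := by
  classical
  have hd := Set.disjoint_left.1 hdisj
  refine ⟨by simpa using hcard, hconn, hpm, ?_⟩
  intro M hM hk
  have hbip' : ∀ u v : V, G.Adj u v → (u ∈ Y ∧ v ∈ X) ∨ (u ∈ X ∧ v ∈ Y) :=
    fun u v h => (hbip u v h).symm
  have hXY : X.ncard = Y.ncard := by
    obtain ⟨P, hP, hs⟩ := hpm
    have h1 := ncard_side G X Y hdisj hbip P hP
    have h2 := ncard_side G Y X hdisj.symm hbip' P hP
    rw [SimpleGraph.Subgraph.isSpanning_iff.1 hs, Set.univ_inter] at h1 h2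
    rw [h1, h2]
  have hMX := ncard_side G X Y hdisj hbip M hM
  have hMY := ncard_side G Y X hdisj.symm hbip' M hM
  rw [hk] at hMX hMY
  have hX' : (X \ M.verts).ncard + k = X.ncard := by
    have := Set.ncard_inter_add_ncard_sdiff_eq_ncard X M.verts
    rw [Set.inter_comm, hMX] at this
    omega
  have hY' : (Y \ M.verts).ncard + k = Y.ncard := by
    have := Set.ncard_inter_add_ncard_sdiff_eq_ncard Y M.verts
    rw [Set.inter_comm, hMY] at this
    omega
  let t : ↥(X \ M.verts) → Finset V := fun x => Finset.univ.filter fun w => G.Adj x w ∧ w ∉ M.verts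
  have hall : ∀ s : Finset ↥(X \ M.verts), s.card ≤ (s.biUnion t).card := by
    intro s
    rcases s.eq_empty_or_nonempty with rfl | hne
    · simp
    set A : Set V := Subtype.val '' (s : Set ↥(X \ M.verts)) with hA
    have hAc : A.ncard = s.card := by
      rw [hA, Set.ncard_image_of_injective _ Subtype.val_injective, Set.ncard_coe_finset]
    have hAX : A ⊆ X \ M.verts := by
      rintro _ ⟨x, _, rfl⟩
      exact x.2
    have hle : A.ncard ≤ (X \ M.verts).ncard := Set.ncard_le_ncard hAX (Set.toFinite _)
    have h1 := hHall A (fun a ha => (hAX ha).1) (by rw [hAc]; exact hne.card_pos) (by omega)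
    have hsub : G.setNeighborhood A ⊆ ((s.biUnion t : Finset V) : Set V) ∪ (M.verts ∩ Y) := by
      rintro v ⟨a, ha, hav⟩
      have haX := (hAX ha).1
      have hvY : v ∈ Y := by
        rcases hbip _ _ hav with h | h
        · exact h.2
        · exact absurd h.1 (hd haX)
      by_cases hv : v ∈ M.verts
      · exact Or.inr ⟨hv, hvY⟩
      · left
        obtain ⟨x, hx, rfl⟩ := ha
        simp only [Finset.coe_biUnion, Set.mem_iUnion]
        exact ⟨x, hx, by simp [t, hav, hv]⟩
    have h2 := Set.ncard_le_ncard hsub (Set.toFinite _)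
    have h3 := Set.ncard_union_le ((s.biUnion t : Finset V) : Set V) (M.verts ∩ Y)
    rw [Set.ncard_coe_finset] at h3
    omega
  obtain ⟨f, hfi, hft⟩ := (Finset.all_card_le_biUnion_card_iff_exists_injective t).1 hall
  have hf : ∀ x : ↥(X \ M.verts), G.Adj x (f x) ∧ f x ∉ M.verts := fun x => by simpa [t] using hft x
  have hfY : ∀ x, f x ∈ Y \ M.verts := fun x => by
    refine ⟨?_, (hf x).2⟩
    rcases hbip _ _ (hf x).1 with h | h
    · exact h.2
    · exact absurd h.1 (hd x.2.1)
  let F : ↥(X \ M.verts) → ↥(Y \ M.verts) := fun x => ⟨f x, hfY x⟩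
  have hF : Function.Bijective F := by
    rw [Fintype.bijective_iff_injective_and_card]
    refine ⟨fun a b h => hfi (congrArg Subtype.val h), ?_⟩
    rw [← Nat.card_eq_fintype_card, ← Nat.card_eq_fintype_card, Nat.card_coe_set_eq,
      Nat.card_coe_set_eq]
    omega
  obtain ⟨N, hNv, hN⟩ := SimpleGraph.Subgraph.IsMatching.exists_of_disjoint_sets_of_equiv
    (hdisj.mono Set.sdiff_subset Set.sdiff_subset) (Equiv.ofBijective F hF) (fun x => (hf x).1)
  refine ⟨M ⊔ N, ⟨hM.sup hN ?_, ?_⟩, le_sup_left⟩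
  · rw [hM.support_eq_verts, hN.support_eq_verts, hNv, Set.disjoint_left]
    rintro a ha (h | h)
    · exact h.2 ha
    · exact h.2 ha
  · intro v
    have hv : v ∈ X ∪ Y := hcover ▸ Set.mem_univ v
    rw [SimpleGraph.Subgraph.verts_sup, hNv]
    by_cases h : v ∈ M.verts
    · exact Or.inl h
    · rcases hv with hv | hv
      · exact Or.inr (Or.inl ⟨hv, h⟩)
      · exact Or.inr (Or.inr ⟨hv, h⟩)
end

section
/- Let G be a connected bipartite graph with bipartition (X,Y) that has a perfect matching, and suppose |V(G)| ≥ 2k+2. If G is k-extendible, then for every subset A ⊆ X with 1 ≤ |A| ≤ |X| - k, the neighborhood of A in G satisfies |N(A)| ≥ |A| + k. -/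
open Classical in
theorem KE.ofPM {V : Type*} (G : SimpleGraph V) (P : G.Subgraph) (hP : P.IsPerfectMatching) :
    ∃ p : V → V, (∀ v, G.Adj v (p v)) ∧ (∀ v, p (p v) = v) ∧ ∀ u v, P.Adj u v → p u = v := by
  have h := SimpleGraph.Subgraph.isPerfectMatching_iff.1 hP
  choose p hp hu using h
  refine ⟨p, fun v => (hp v).adj_sub, fun v => ?_, fun u v huv => (hu u v huv).symm⟩
  exact (hu (p v) v (hp v).symm).symm

open Classical in
theorem KE.ext {V : Type*} [Fintype V] (G : SimpleGraph V) (k : ℕ)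
    (X : Finset V) (hX : ∀ u v, G.Adj u v → (u ∈ X ↔ v ∉ X))
    (hext : G.IsKExtendible k) (S : Finset V) (hS : S ⊆ X) (f : V → V)
    (hf : ∀ x ∈ S, G.Adj x (f x)) (hinj : Set.InjOn f S) (hk : S.card = k) :
    ∃ p : V → V, (∀ v, G.Adj v (p v)) ∧ (∀ v, p (p v) = v) ∧ ∀ x ∈ S, p x = f x := by
  have hfX : ∀ x ∈ S, f x ∉ X := fun x hx => (hX _ _ (hf x hx)).1 (hS hx)
  let M : G.Subgraph :=
    { verts := {v | v ∈ S ∨ ∃ x ∈ S, f x = v}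
      Adj := fun u v => (u ∈ S ∧ f u = v) ∨ (v ∈ S ∧ f v = u)
      adj_sub := by
        rintro u v (⟨h, rfl⟩ | ⟨h, rfl⟩)
        · exact hf _ h
        · exact (hf _ h).symm
      edge_vert := by
        rintro u v (⟨h, rfl⟩ | ⟨h, rfl⟩)
        · exact Or.inl h
        · exact Or.inr ⟨_, h, rfl⟩
      symm := ⟨by
        rintro u v (h | h)
        · exact Or.inr h
        · exact Or.inl h⟩ }
  have hM : M.IsMatching := by
    rintro v (hv | ⟨x, hx, rfl⟩)
    · refine ⟨f v, Or.inl ⟨hv, rfl⟩, ?_⟩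
      rintro w (⟨_, h⟩ | ⟨h, h'⟩)
      · exact h.symm
      · exact absurd (hS hv) (h' ▸ hfX w h)
    · refine ⟨x, Or.inr ⟨hx, rfl⟩, ?_⟩
      rintro w (⟨h, _⟩ | ⟨h, h'⟩)
      · exact absurd (hS h) (hfX x hx)
      · exact hinj h hx h'
  have hE : M.edgeSet = (fun x => s(x, f x)) '' (S : Set V) := by
    ext e
    induction e using Sym2.ind with
    | _ u v =>
      simp only [SimpleGraph.Subgraph.mem_edgeSet, Set.mem_image, Finset.mem_coe, Sym2.eq_iff]
      constructor
      · rintro (⟨h, h'⟩ | ⟨h, h'⟩)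
        · exact ⟨u, h, Or.inl ⟨rfl, h'⟩⟩
        · exact ⟨v, h, Or.inr ⟨rfl, h'⟩⟩
      · rintro ⟨x, hx, (⟨rfl, h'⟩ | ⟨rfl, h'⟩)⟩
        · exact Or.inl ⟨hx, h'⟩
        · exact Or.inr ⟨hx, h'⟩
  have hc : M.edgeSet.ncard = k := by
    rw [hE, Set.ncard_image_of_injOn, Set.ncard_coe_finset, hk]
    intro x hx y hy h
    rcases Sym2.eq_iff.1 h with h | h
    · exact h.1
    · exact absurd (hS hx) (h.1 ▸ hfX y hy)
  obtain ⟨P, hP, hMP⟩ := hext.2.2.2 M hM hc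
  obtain ⟨p, h1, h2, h3⟩ := KE.ofPM G P hP
  exact ⟨p, h1, h2, fun x hx => h3 _ _ (hMP.2 (Or.inl ⟨hx, rfl⟩))⟩

open Classical in
theorem KE.strict {V : Type*} [Fintype V] (G : SimpleGraph V) (k : ℕ) (hk : 1 ≤ k)
    (X : Finset V) (hX : ∀ u v, G.Adj u v → (u ∈ X ↔ v ∉ X))
    (hext : G.IsKExtendible k) (hXk : k + 1 ≤ X.card)
    (C : Finset V) (hC : C ⊆ X) (hne : C.Nonempty) (a : V) (ha : a ∈ X) (haC : a ∉ C)
    (N : Finset V) (hN : ∀ v, v ∈ N ↔ ∃ c ∈ C, G.Adj c v) :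
    C.card + 1 ≤ N.card := by
  by_contra hlt
  obtain ⟨P, hP⟩ := hext.2.2.1
  obtain ⟨q, q1, q2, -⟩ := KE.ofPM G P hP
  have key : ∀ p : V → V, (∀ v, G.Adj v (p v)) → (∀ v, p (p v) = v) → C.image p = N := by
    intro p p1 p2
    apply Finset.eq_of_subset_of_card_le
    · intro v hv
      obtain ⟨c, hc, rfl⟩ := Finset.mem_image.1 hv
      exact (hN _).2 ⟨c, hc, p1 c⟩
    · rw [Finset.card_image_of_injective _ (Function.LeftInverse.injective p2)]
      omega
  obtain ⟨c, hc⟩ := hne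
  have haN : a ∉ N := fun h => by
    obtain ⟨c, hc, h'⟩ := (hN a).1 h
    exact (hX _ _ h').1 (hC hc) ha
  obtain ⟨w⟩ := hext.2.1.preconnected c a
  obtain ⟨d, -, hd1, hd2⟩ := w.exists_boundary_dart {v | v ∈ C ∨ v ∈ N} (Or.inl hc)
    (by rintro (h | h); exacts [haC h, haN h])
  obtain ⟨⟨u, v⟩, huv⟩ := d
  simp only [Set.mem_setOf_eq, not_or] at hd1 hd2 huv
  have huN : u ∈ N := by
    rcases hd1 with h | h
    · exact absurd ((hN v).2 ⟨u, h, huv⟩) hd2.2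
    · exact h
  have huX : u ∉ X := by
    obtain ⟨c, hc, h'⟩ := (hN u).1 huN
    exact (hX _ _ h').1 (hC hc)
  have hvX : v ∈ X := by
    have := hX _ _ huv
    tauto
  have hquC : q u ∈ C := by
    rw [← key q q1 q2] at huN
    obtain ⟨c, hc, rfl⟩ := Finset.mem_image.1 huN
    rwa [q2]
  have hvq : v ≠ q u := fun h => hd2.1 (h ▸ hquC)
  obtain ⟨S, hS1, hS2, hS3⟩ := Finset.exists_subsuperset_card_eq (s := {v}) (t := X.erase (q u))
    (n := k) (by simp [hvq, hvX]) (by simpa using hk)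
    (by rw [Finset.card_erase_of_mem (hC hquC)]; omega)
  have hvS : v ∈ S := hS1 (by simp)
  obtain ⟨p, p1, p2, p3⟩ := KE.ext G k X hX hext S (hS2.trans (Finset.erase_subset _ _))
    (Function.update q v u)
    (by
      intro x hx
      by_cases h : x = v
      · subst h; simpa using huv.symm
      · simpa [h] using q1 x)
    (by
      have hz : ∀ x ∈ S, q x ≠ u := by
        intro x hx h
        have := Finset.ne_of_mem_erase (hS2 hx)
        rw [← h, q2] at this
        exact this rfl
      intro x hx y hy h
      by_cases h1 : x = v <;> by_cases h2 : y = v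
      · rw [h1, h2]
      · subst h1; simp [h2] at h
        exact absurd h.symm (hz y hy)
      · subst h2; simp [h1] at h
        exact absurd h (hz x hx)
      · simp [h1, h2] at h
        exact Function.LeftInverse.injective q2 h) hS3
  have h4 := p3 v hvS
  simp at h4
  rw [← key p p1 p2] at huN
  obtain ⟨c', hc', h5⟩ := Finset.mem_image.1 huN
  have : c' = v := Function.LeftInverse.injective p2 (h5.trans h4.symm)
  exact hd2.1 (this ▸ hc')

open Classical in
theorem KE.main {V : Type*} [Fintype V] (G : SimpleGraph V) (k : ℕ)
    (X : Finset V) (hX : ∀ u v, G.Adj u v → (u ∈ X ↔ v ∉ X))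
    (hext : G.IsKExtendible k)
    (A : Finset V) (hA : A ⊆ X) (hne : A.Nonempty) (hAX : A.card + k ≤ X.card)
    (N : Finset V) (hN : ∀ v, v ∈ N ↔ ∃ c ∈ A, G.Adj c v) :
    A.card + k ≤ N.card := by
  by_contra hlt
  obtain ⟨P, hP⟩ := hext.2.2.1
  obtain ⟨q, q1, q2, -⟩ := KE.ofPM G P hP
  have qi := Function.LeftInverse.injective q2
  have hY : X.image q = Xᶜ := by
    ext y
    simp only [Finset.mem_image, Finset.mem_compl]
    constructor
    · rintro ⟨x, hx, rfl⟩
      exact (hX _ _ (q1 x)).1 hx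
    · intro h
      refine ⟨q y, ?_, q2 y⟩
      have := hX _ _ (q1 y)
      tauto
  have hYc : (Xᶜ).card = X.card := by
    rw [← hY, Finset.card_image_of_injective _ qi]
  have hXk : k + 1 ≤ X.card := by
    have h1 := Finset.card_add_card_compl X
    have h2 := hext.1
    rw [Nat.card_eq_fintype_card] at h2
    omega
  have hAN : A.card ≤ N.card := by
    rw [← Finset.card_image_of_injective A qi]
    apply Finset.card_le_card
    intro v hv
    obtain ⟨c, hc, rfl⟩ := Finset.mem_image.1 hv
    exact (hN _).2 ⟨c, hc, q1 c⟩
  have hk : 1 ≤ k := by omega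
  have hNY : N ⊆ Xᶜ := by
    intro v hv
    obtain ⟨c, hc, h⟩ := (hN v).1 hv
    exact Finset.mem_compl.2 ((hX _ _ h).1 (hA hc))
  obtain ⟨y0, hy0, hy0N⟩ : ∃ y ∈ Xᶜ, y ∉ N :=
    Finset.exists_mem_notMem_of_card_lt_card (by omega)
  obtain ⟨a, ha⟩ := hne
  have haX := hA ha
  -- Hall
  have hall : ∃ g : {x // x ∈ X.erase a} → V, Function.Injective g ∧
      ∀ x, g x ∈ (Finset.univ.filter (fun y => G.Adj x.1 y ∧ y ≠ y0)) := by
    apply (Finset.all_card_le_biUnion_card_iff_exists_injective _).1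
    intro s
    rcases s.eq_empty_or_nonempty with rfl | hs
    · simp
    have h := KE.strict G k hk X hX hext hXk (s.map (Function.Embedding.subtype _))
      (by
        intro x hx
        simp only [Finset.mem_map, Function.Embedding.coe_subtype] at hx
        obtain ⟨x, -, rfl⟩ := hx
        exact Finset.mem_of_mem_erase x.2)
      (by simpa using hs) a haX
      (by
        intro hx
        simp only [Finset.mem_map, Function.Embedding.coe_subtype] at hx
        obtain ⟨x, -, h⟩ := hx
        exact Finset.ne_of_mem_erase x.2 h)
      (Finset.univ.filter
        (fun v => ∃ c ∈ s.map (Function.Embedding.subtype _), G.Adj c v)) (by simp)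
    rw [Finset.card_map] at h
    have h2 := Finset.pred_card_le_card_erase (a := y0) (s := Finset.univ.filter
        (fun v => ∃ c ∈ s.map (Function.Embedding.subtype _), G.Adj c v))
    refine le_trans (by omega) (h2.trans (Finset.card_le_card ?_))
    intro v hv
    simp only [Finset.mem_erase, Finset.mem_filter, Finset.mem_univ, true_and, Finset.mem_map,
      Function.Embedding.coe_subtype] at hv
    obtain ⟨hv0, c, ⟨x, hx, rfl⟩, hadj⟩ := hv
    simp only [Finset.mem_biUnion, Finset.mem_filter, Finset.mem_univ, true_and]
    exact ⟨x, hx, hadj, hv0⟩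
  obtain ⟨g, gi, hg⟩ := hall
  simp only [Finset.mem_filter, Finset.mem_univ, true_and] at hg
  obtain ⟨f, hf⟩ : ∃ f : V → V, ∀ x (h : x ∈ X.erase a), f x = g ⟨x, h⟩ :=
    ⟨fun x => if h : x ∈ X.erase a then g ⟨x, h⟩ else x, fun x h => dif_pos h⟩
  have fadj : ∀ x ∈ X.erase a, G.Adj x (f x) := fun x h => by
    rw [hf x h]; exact (hg ⟨x, h⟩).1
  have fne : ∀ x ∈ X.erase a, f x ≠ y0 := fun x h => by
    rw [hf x h]; exact (hg ⟨x, h⟩).2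
  have finj : Set.InjOn f (X.erase a : Finset V) := by
    intro x hx y hy h
    rw [hf x hx, hf y hy] at h
    exact congrArg Subtype.val (gi h)
  have himg : (X.erase a).image f = (Xᶜ).erase y0 := by
    apply Finset.eq_of_subset_of_card_le
    · intro v hv
      obtain ⟨x, hx, rfl⟩ := Finset.mem_image.1 hv
      exact Finset.mem_erase.2 ⟨fne x hx,
        Finset.mem_compl.2 ((hX _ _ (fadj x hx)).1 (Finset.mem_of_mem_erase hx))⟩
    · rw [Finset.card_image_of_injOn finj, Finset.card_erase_of_mem hy0,
        Finset.card_erase_of_mem haX, hYc]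
  set T := (X \ A).filter (fun x => f x ∈ N) with hT
  have hTN : N.card + 1 - A.card ≤ T.card := by
    have h1 : N ⊆ T.image f ∪ (A.erase a).image f := by
      intro v hv
      have : v ∈ (X.erase a).image f := by
        rw [himg]
        exact Finset.mem_erase.2 ⟨fun h => hy0N (h ▸ hv), hNY hv⟩
      obtain ⟨x, hx, rfl⟩ := Finset.mem_image.1 this
      rw [Finset.mem_erase] at hx
      by_cases hxA : x ∈ A
      · exact Finset.mem_union_right _
          (Finset.mem_image_of_mem _ (Finset.mem_erase.2 ⟨hx.1, hxA⟩))
      · exact Finset.mem_union_left _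
          (Finset.mem_image_of_mem _ (by simp [hT, hx.2, hxA, hv]))
    have h2 := (Finset.card_le_card h1).trans (Finset.card_union_le _ _)
    have h3 : (T.image f).card ≤ T.card := Finset.card_image_le
    have h4 : ((A.erase a).image f).card ≤ (A.erase a).card := Finset.card_image_le
    rw [Finset.card_erase_of_mem ha] at h4
    have := Finset.card_pos.2 ⟨a, ha⟩
    omega
  obtain ⟨T', hT', hT'c⟩ := Finset.exists_subset_card_eq hTN
  obtain ⟨S, hS1, hS2, hS3⟩ := Finset.exists_subsuperset_card_eq (s := T') (t := X.erase a)
    (n := k)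
    (by
      intro x hx
      have := hT' hx
      simp only [hT, Finset.mem_filter, Finset.mem_sdiff] at this
      exact Finset.mem_erase.2 ⟨fun h => this.1.2 (h ▸ ha), this.1.1⟩)
    (by omega)
    (by rw [Finset.card_erase_of_mem haX]; omega)
  obtain ⟨p, p1, p2, p3⟩ := KE.ext G k X hX hext S (hS2.trans (Finset.erase_subset _ _)) f
    (fun x hx => fadj x (hS2 hx)) (finj.mono (by exact_mod_cast hS2)) hS3
  have hd : Disjoint A T' := by
    rw [Finset.disjoint_left]
    intro x hx hx'
    have := hT' hx'
    simp only [hT, Finset.mem_filter, Finset.mem_sdiff] at this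
    exact this.1.2 hx
  have hfin : ((A ∪ T').image p).card ≤ N.card := by
    apply Finset.card_le_card
    intro v hv
    obtain ⟨x, hx, rfl⟩ := Finset.mem_image.1 hv
    rcases Finset.mem_union.1 hx with h | h
    · exact (hN _).2 ⟨x, h, p1 x⟩
    · rw [p3 x (hS1 h)]
      exact (Finset.mem_filter.1 (hT' h)).2
  rw [Finset.card_image_of_injective _ (Function.LeftInverse.injective p2),
    Finset.card_union_of_disjoint hd] at hfin
  omega

/-- Necessity: in a `k`-extendible connected bipartite graph with a perfect matching
and at least `2k+2` vertices, every `A ⊆ X` with `1 ≤ |A| ≤ |X| - k` has `|N(A)| ≥ |A| + k`. -/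
theorem kExtendible_implies_bipartite_hall {V : Type*} [Fintype V]
    (G : SimpleGraph V) (k : ℕ) (X Y : Set V)
    (hcover : X ∪ Y = Set.univ) (hdisj : Disjoint X Y)
    (hbip : ∀ u v : V, G.Adj u v → (u ∈ X ∧ v ∈ Y) ∨ (u ∈ Y ∧ v ∈ X))
    (hconn : G.Connected) (hpm : ∃ P : G.Subgraph, P.IsPerfectMatching)
    (hcard : 2 * k + 2 ≤ Fintype.card V)
    (hext : G.IsKExtendible k) :
    ∀ A : Set V, A ⊆ X → 1 ≤ A.ncard → A.ncard + k ≤ X.ncard →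
      A.ncard + k ≤ (G.setNeighborhood A).ncard := by
  classical
  intro A hA h1 h2
  rw [Set.ncard_eq_toFinset_card' A] at *
  rw [Set.ncard_eq_toFinset_card' X] at h2
  rw [Set.ncard_eq_toFinset_card' (G.setNeighborhood A)]
  refine KE.main G k X.toFinset ?_ hext A.toFinset ?_ (Finset.card_pos.1 h1) h2 _ ?_
  · intro u v huv
    rw [Set.mem_toFinset, Set.mem_toFinset]
    have hd := Set.disjoint_left.1 hdisj
    have := hbip u v huv
    have h3 := @hd u
    have h4 := @hd v
    tauto
  · simpa using hA
  · intro v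
    rw [Set.mem_toFinset]
    simp only [Set.mem_toFinset]
    exact Iff.rfl
end

section
/- Let G be a connected bipartite graph with bipartition (X,Y) that has a perfect matching, and suppose |V(G)| ≥ 2k+2. Then G is k-extendible if and only if for every subset A ⊆ X with 1 ≤ |A| ≤ |X| - k, the neighborhood of A in G satisfies |N(A)| ≥ |A| + k. -/
theorem hall_set {V : Type*} [Fintype V] (r : V → V → Prop) (B : Set V)
    (h : ∀ T ⊆ B, T.ncard ≤ {v | ∃ a ∈ T, r a v}.ncard) :
    ∃ f : V → V, Set.InjOn f B ∧ ∀ x ∈ B, r x (f x) := by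
  classical
  obtain ⟨f, hf₁, hf₂⟩ := (Finset.all_card_le_biUnion_card_iff_exists_injective
      (fun (x : B) ↦ Finset.univ.filter (fun v => r x v))).mp (fun s ↦ by
    have := h (s.image Subtype.val : Finset V) (by simp)
    rw [Set.ncard_coe_finset, Finset.card_image_of_injective _ Subtype.val_injective] at this
    refine this.trans (le_of_eq ?_)
    rw [← Set.ncard_coe_finset]
    congr 1
    ext v
    simp)
  refine ⟨fun x => if hx : x ∈ B then f ⟨x, hx⟩ else x, ?_, ?_⟩
  · intro x hx y hy hxy
    simp only [hx, hy, dif_pos] at hxy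
    exact congrArg Subtype.val (hf₁ hxy)
  · intro x hx
    have := hf₂ ⟨x, hx⟩
    simpa [hx] using this

theorem mk_matching {V : Type*} [Fintype V] (G : SimpleGraph V) (X Y : Set V)
    (hdisj : Disjoint X Y)
    (hbip : ∀ u v : V, G.Adj u v → (u ∈ X ∧ v ∈ Y) ∨ (u ∈ Y ∧ v ∈ X))
    (S : Set V) (hS : S ⊆ X) (f : V → V) (hf : Set.InjOn f S) (hadj : ∀ x ∈ S, G.Adj x (f x)) :
    ∃ M : G.Subgraph, M.IsMatching ∧ M.edgeSet.ncard = S.ncard ∧ M.verts = S ∪ f '' S ∧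
      ∀ x ∈ S, M.Adj x (f x) := by
  have hd : ∀ x, x ∈ X → x ∈ Y → False := fun x h1 h2 => Set.disjoint_left.mp hdisj h1 h2
  have hY : ∀ x ∈ S, f x ∈ Y := fun x hx => by
    rcases hbip _ _ (hadj x hx) with h | h
    · exact h.2
    · exact (hd x (hS hx) h.1).elim
  let M : G.Subgraph :=
    { verts := S ∪ f '' S
      Adj := fun u v => (u ∈ S ∧ v = f u) ∨ (v ∈ S ∧ u = f v)
      adj_sub := by
        rintro u v (⟨h, rfl⟩ | ⟨h, rfl⟩)
        · exact hadj _ h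
        · exact (hadj _ h).symm
      edge_vert := by
        rintro u v (⟨h, rfl⟩ | ⟨h, rfl⟩)
        · exact Or.inl h
        · exact Or.inr ⟨_, h, rfl⟩
      symm.symm := by
        rintro u v h
        exact h.symm }
  refine ⟨M, ?_, ?_, rfl, fun x hx => Or.inl ⟨hx, rfl⟩⟩
  · rintro v (hv | ⟨x, hx, rfl⟩)
    · refine ⟨f v, Or.inl ⟨hv, rfl⟩, ?_⟩
      rintro w (⟨_, h⟩ | ⟨h, h'⟩)
      · exact h
      · exact (hd v (hS hv) (h' ▸ hY w h)).elim
    · refine ⟨x, Or.inr ⟨hx, rfl⟩, ?_⟩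
      rintro w (⟨h, _⟩ | ⟨h, h'⟩)
      · exact (hd _ (hS h) (hY x hx)).elim
      · exact (hf hx h h').symm
  · have : M.edgeSet = (fun x => s(x, f x)) '' S := by
      ext e
      induction e with
      | _ u v =>
        simp only [SimpleGraph.Subgraph.mem_edgeSet, Set.mem_image, M]
        constructor
        · rintro (⟨h, rfl⟩ | ⟨h, rfl⟩)
          · exact ⟨u, h, rfl⟩
          · exact ⟨v, h, Sym2.eq_swap⟩
        · rintro ⟨x, hx, h⟩
          rcases Sym2.eq_iff.mp h with ⟨rfl, rfl⟩ | ⟨rfl, rfl⟩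
          · exact Or.inl ⟨hx, rfl⟩
          · exact Or.inr ⟨hx, rfl⟩
    rw [this]
    apply Set.InjOn.ncard_image
    intro x hx y hy h
    rcases Sym2.eq_iff.mp h with ⟨h1, _⟩ | ⟨h1, _⟩
    · exact h1
    · exact (hd x (hS hx) (h1 ▸ hY y hy)).elim

theorem pm_fun {V : Type*} (G : SimpleGraph V) (P : G.Subgraph) (hP : P.IsPerfectMatching) :
    ∃ p : V → V, Function.Injective p ∧ (∀ v, P.Adj v (p v)) := by
  have h := SimpleGraph.Subgraph.isPerfectMatching_iff.mp hP
  choose p hp _ using fun v => h v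
  refine ⟨p, fun a b hab => ?_, hp⟩
  have h1 := hp a
  have h2 := hp b
  rw [← hab] at h2
  exact hP.1.eq_of_adj_right h1 h2

theorem ext_fun {V : Type*} [Fintype V] (G : SimpleGraph V) (k : ℕ) (X Y : Set V)
    (hdisj : Disjoint X Y)
    (hbip : ∀ u v : V, G.Adj u v → (u ∈ X ∧ v ∈ Y) ∨ (u ∈ Y ∧ v ∈ X))
    (hk : G.IsKExtendible k)
    (S : Set V) (hS : S ⊆ X) (hSk : S.ncard = k)
    (f : V → V) (hf : Set.InjOn f S) (hadj : ∀ x ∈ S, G.Adj x (f x)) :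
    ∃ g : V → V, Function.Injective g ∧ (∀ v, G.Adj v (g v)) ∧ ∀ x ∈ S, g x = f x := by
  obtain ⟨M, hM, hMc, -, hMa⟩ := mk_matching G X Y hdisj hbip S hS f hf hadj
  obtain ⟨P, hP, hle⟩ := hk.2.2.2 M hM (hMc.trans hSk)
  obtain ⟨g, hg, hgP⟩ := pm_fun G P hP
  exact ⟨g, hg, fun v => (hgP v).adj_sub, fun x hx =>
    hP.1.eq_of_adj_left (hgP x) (hle.2 (hMa x hx))⟩

theorem card_XY {V : Type*} [Fintype V] (G : SimpleGraph V) (X Y : Set V)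
    (hcover : X ∪ Y = Set.univ) (hdisj : Disjoint X Y)
    (hbip : ∀ u v : V, G.Adj u v → (u ∈ X ∧ v ∈ Y) ∨ (u ∈ Y ∧ v ∈ X))
    (p : V → V) (hp : Function.Injective p) (hpa : ∀ v, G.Adj v (p v)) :
    X.ncard = Y.ncard ∧ 2 * X.ncard = Fintype.card V := by
  have hd : ∀ x, x ∈ X → x ∈ Y → False := fun x h1 h2 => Set.disjoint_left.mp hdisj h1 h2
  have h1 : X.ncard ≤ Y.ncard := by
    refine Set.ncard_le_ncard_of_injOn p (fun x hx => ?_) hp.injOn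
    rcases hbip _ _ (hpa x) with h | h
    · exact h.2
    · exact (hd x hx h.1).elim
  have h2 : Y.ncard ≤ X.ncard := by
    refine Set.ncard_le_ncard_of_injOn p (fun x hx => ?_) hp.injOn
    rcases hbip _ _ (hpa x) with h | h
    · exact (hd x h.1 hx).elim
    · exact h.2
  have h3 := Set.ncard_union_eq hdisj
  rw [hcover, Set.ncard_univ, Nat.card_eq_fintype_card] at h3
  omega

theorem exists_cut_edge {V : Type*} (G : SimpleGraph V) (hconn : G.Connected) (C : Set V)
    (a b : V) (ha : a ∈ C) (hb : b ∉ C) : ∃ u v, u ∈ C ∧ v ∉ C ∧ G.Adj u v := by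
  obtain ⟨w⟩ := hconn.preconnected a b
  obtain ⟨d, -, h1, h2⟩ := w.exists_boundary_dart C ha hb
  exact ⟨_, _, h1, h2, d.adj⟩

theorem surplus_one {V : Type*} [Fintype V] (G : SimpleGraph V) (k : ℕ) (X Y : Set V)
    (hcover : X ∪ Y = Set.univ) (hdisj : Disjoint X Y)
    (hbip : ∀ u v : V, G.Adj u v → (u ∈ X ∧ v ∈ Y) ∨ (u ∈ Y ∧ v ∈ X))
    (hk : G.IsKExtendible k) (hk1 : 1 ≤ k) (hkX : k + 1 ≤ X.ncard)
    (T : Set V) (hT : T ⊆ X) (hne : T.Nonempty) (hTX : T ≠ X) :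
    T.ncard + 1 ≤ (G.setNeighborhood T).ncard := by
  classical
  have hd : ∀ x, x ∈ X → x ∈ Y → False := fun x h1 h2 => Set.disjoint_left.mp hdisj h1 h2
  obtain ⟨P, hP⟩ := hk.2.2.1
  obtain ⟨p, hp, hpP⟩ := pm_fun G P hP
  have hpa : ∀ v, G.Adj v (p v) := fun v => (hpP v).adj_sub
  have hsub : p '' T ⊆ G.setNeighborhood T := by
    rintro _ ⟨x, hx, rfl⟩
    exact ⟨x, hx, hpa x⟩
  by_contra hcon
  have heq : p '' T = G.setNeighborhood T := by
    apply Set.eq_of_subset_of_ncard_le hsub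
    rw [Set.ncard_image_of_injective _ hp]
    omega
  have hNY : G.setNeighborhood T ⊆ Y := by
    rintro v ⟨x, hx, h⟩
    rcases hbip _ _ h with h | h
    · exact h.2
    · exact (hd x (hT hx) h.1).elim
  obtain ⟨a, ha⟩ := hne
  obtain ⟨b, hb, hbT⟩ := Set.exists_of_ssubset (hT.ssubset_of_ne hTX)
  obtain ⟨u, v, hu, hv, huv⟩ := exists_cut_edge G hk.2.1 (T ∪ G.setNeighborhood T) a b (Or.inl ha)
    (by rintro (h | h); exacts [hbT h, hd b hb (hNY h)])
  have hvT : v ∉ T := fun h => hv (Or.inl h)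
  have huN : u ∈ G.setNeighborhood T := by
    rcases hu with hu | hu
    · exact (hv (Or.inr ⟨u, hu, huv⟩)).elim
    · exact hu
  have hvX : v ∈ X := by
    rcases hbip _ _ huv with h | h
    · exact (hd u h.1 (hNY huN)).elim
    · exact h.2
  obtain ⟨x, hxT, hxu⟩ : u ∈ p '' T := heq ▸ huN
  have hvx : v ≠ x := fun h => hvT (h ▸ hxT)
  obtain ⟨S, hS1, hS2, hSk⟩ := Set.exists_subsuperset_card_eq (s := {v}) (t := X \ {x}) (n := k)
    (by simpa using ⟨hvX, hvx⟩) (by simpa using hk1)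
    (by rw [Set.ncard_sdiff_singleton_of_mem (hT hxT)]; omega)
  have hvS : v ∈ S := hS1 rfl
  have hxS : x ∉ S := fun h => (hS2 h).2 rfl
  obtain ⟨g, hg, hga, hgS⟩ := ext_fun G k X Y hdisj hbip hk S (hS2.trans Set.sdiff_subset) hSk
    (Function.update p v u) (by
      intro s hs t ht hst
      have key : ∀ s ∈ S, p s ≠ u := fun s hs h => hxS (by
        rw [← hxu] at h
        exact hp h ▸ hs)
      by_cases h1 : s = v <;> by_cases h2 : t = v
      · rw [h1, h2]
      · subst h1
        simp [h2] at hst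
        exact (key t ht hst.symm).elim
      · subst h2
        simp [h1] at hst
        exact (key s hs hst).elim
      · simp [h1, h2] at hst
        exact hp hst) (by
      intro s hs
      by_cases h1 : s = v
      · subst h1
        simpa using huv.symm
      · simpa [h1] using hpa s)
  apply hcon
  rw [← Set.ncard_insert_of_notMem hvT, ← Set.ncard_image_of_injective _ hg]
  refine Set.ncard_le_ncard ?_ (Set.toFinite _)
  rintro _ ⟨t, (rfl | ht), rfl⟩
  · rw [hgS _ hvS]
    simpa using huN
  · exact ⟨t, ht, hga t⟩

theorem ext_imp_hall {V : Type*} [Fintype V] (G : SimpleGraph V) (k : ℕ) (X Y : Set V)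
    (hcover : X ∪ Y = Set.univ) (hdisj : Disjoint X Y)
    (hbip : ∀ u v : V, G.Adj u v → (u ∈ X ∧ v ∈ Y) ∨ (u ∈ Y ∧ v ∈ X))
    (hk : G.IsKExtendible k) (hkX : k + 1 ≤ X.ncard) (hXY : X.ncard = Y.ncard)
    (A : Set V) (hA : A ⊆ X) (hA1 : 1 ≤ A.ncard) (hAk : A.ncard + k ≤ X.ncard) :
    A.ncard + k ≤ (G.setNeighborhood A).ncard := by
  classical
  have hd : ∀ x, x ∈ X → x ∈ Y → False := fun x h1 h2 => Set.disjoint_left.mp hdisj h1 h2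
  have hXadj : ∀ x y, x ∈ X → G.Adj x y → y ∈ Y := by
    intro x y hx h
    rcases hbip _ _ h with h | h
    · exact h.2
    · exact (hd x hx h.1).elim
  obtain ⟨P, hP⟩ := hk.2.2.1
  obtain ⟨p, hp, hpP⟩ := pm_fun G P hP
  have hpa : ∀ v, G.Adj v (p v) := fun v => (hpP v).adj_sub
  set N := G.setNeighborhood A with hN
  have hNY : N ⊆ Y := by
    rintro v ⟨x, hx, h⟩
    exact hXadj x v (hA hx) h
  have hAN : A.ncard ≤ N.ncard :=
    Set.ncard_le_ncard_of_injOn p (fun x hx => ⟨x, hx, hpa x⟩) hp.injOn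
  by_contra hcon
  have hAne : A.Nonempty := by
    rw [← Set.ncard_pos]; omega
  have hYN := Set.ncard_sdiff_add_ncard_of_subset hNY
  have hXA := Set.ncard_sdiff_add_ncard_of_subset hA
  obtain ⟨y, hyY, hyN⟩ : (Y \ N).Nonempty := by
    rw [← Set.ncard_pos]; omega
  obtain ⟨f, hf, hfr⟩ := hall_set (fun a v => G.Adj a v ∧ v ≠ y) (X \ A) (by
    intro T hT
    rcases T.eq_empty_or_nonempty with rfl | hne
    · simp
    have h1 := surplus_one G k X Y hcover hdisj hbip hk (by omega) hkX T
      (hT.trans Set.sdiff_subset) hne (by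
        rintro rfl
        obtain ⟨a, ha⟩ := hAne
        exact (hT (hA ha)).2 ha)
    have h2 : G.setNeighborhood T ⊆ insert y {v | ∃ a ∈ T, G.Adj a v ∧ v ≠ y} := by
      rintro v ⟨a, ha, h⟩
      by_cases hvy : v = y
      · exact Or.inl hvy
      · exact Or.inr ⟨a, ha, h, hvy⟩
    have h3 := Set.ncard_le_ncard h2
    have h4 := Set.ncard_insert_le y {v | ∃ a ∈ T, G.Adj a v ∧ v ≠ y}
    omega)
  -- the part of `X \ A` sent into `N`
  set B := X \ A with hB
  set B1 := {b ∈ B | f b ∈ N} with hB1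
  have hB1B : B1 ⊆ B := fun b hb => hb.1
  have hrest : (B \ B1).ncard ≤ ((Y \ N) \ {y}).ncard := by
    refine Set.ncard_le_ncard_of_injOn f ?_ (hf.mono Set.sdiff_subset)
    rintro b ⟨hb, hb1⟩
    exact ⟨⟨hXadj b _ hb.1 (hfr b hb).1, fun h => hb1 ⟨hb, h⟩⟩, (hfr b hb).2⟩
  rw [Set.ncard_sdiff_singleton_of_mem (show y ∈ Y \ N from ⟨hyY, hyN⟩)] at hrest
  have hBB := Set.ncard_sdiff_add_ncard_of_subset hB1B
  have hpos : 0 < (Y \ N).ncard := (Set.ncard_pos).mpr ⟨y, hyY, hyN⟩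
  -- choose d+1 elements
  obtain ⟨S0, hS0, hS0c⟩ := Set.exists_subset_card_eq (s := B1) (n := N.ncard - A.ncard + 1)
    (by omega)
  obtain ⟨S, hS1, hS2, hSk⟩ := Set.exists_subsuperset_card_eq (s := S0) (t := B) (n := k)
    (hS0.trans hB1B) (by omega) (by omega)
  obtain ⟨g, hg, hga, hgS⟩ := ext_fun G k X Y hdisj hbip hk S (hS2.trans Set.sdiff_subset) hSk
    f (hf.mono hS2) (fun x hx => (hfr x (hS2 hx)).1)
  have hfin : (A ∪ S0).ncard ≤ N.ncard := by
    refine Set.ncard_le_ncard_of_injOn g ?_ hg.injOn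
    rintro x (hx | hx)
    · exact ⟨x, hx, hga x⟩
    · rw [hgS x (hS1 hx)]
      exact (hS0 hx).2
  rw [Set.ncard_union_eq (Set.disjoint_left.mpr fun x hx hx' => (hB1B (hS0 hx')).2 hx)] at hfin
  omega

theorem hall_imp_ext {V : Type*} [Fintype V] (G : SimpleGraph V) (k : ℕ) (X Y : Set V)
    (hcover : X ∪ Y = Set.univ) (hdisj : Disjoint X Y)
    (hbip : ∀ u v : V, G.Adj u v → (u ∈ X ∧ v ∈ Y) ∨ (u ∈ Y ∧ v ∈ X))
    (hXY : X.ncard = Y.ncard)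
    (hall : ∀ A : Set V, A ⊆ X → 1 ≤ A.ncard → A.ncard + k ≤ X.ncard →
        A.ncard + k ≤ (G.setNeighborhood A).ncard)
    (M : G.Subgraph) (hM : M.IsMatching) (hMk : M.edgeSet.ncard = k) :
    ∃ P : G.Subgraph, P.IsPerfectMatching ∧ M ≤ P := by
  classical
  have hd : ∀ x, x ∈ X → x ∈ Y → False := fun x h1 h2 => Set.disjoint_left.mp hdisj h1 h2
  have hXadj : ∀ x y, x ∈ X → G.Adj x y → y ∈ Y := by
    intro x y hx h
    rcases hbip _ _ h with h | h
    · exact h.2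
    · exact (hd x hx h.1).elim
  have hm' : ∀ v, ∃ w, v ∈ M.verts → M.Adj v w := by
    intro v
    by_cases hv : v ∈ M.verts
    · obtain ⟨w, hw, _⟩ := hM hv
      exact ⟨w, fun _ => hw⟩
    · exact ⟨v, fun h => (hv h).elim⟩
  choose m hm using hm'
  set S := X ∩ M.verts with hS
  have hSk : S.ncard = k := by
    have : M.edgeSet = (fun x => s(x, m x)) '' S := by
      ext e
      induction e with
      | _ u v =>
        simp only [SimpleGraph.Subgraph.mem_edgeSet, Set.mem_image]
        constructor
        · intro h
          rcases hbip _ _ h.adj_sub with h' | h'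
          · exact ⟨u, ⟨h'.1, h.fst_mem⟩, by rw [hM.eq_of_adj_left h (hm u h.fst_mem)]⟩
          · refine ⟨v, ⟨h'.2, h.snd_mem⟩, ?_⟩
            rw [hM.eq_of_adj_left h.symm (hm v h.snd_mem)]
            exact Sym2.eq_swap
        · rintro ⟨x, hx, h⟩
          have := hm x hx.2
          rcases Sym2.eq_iff.mp h with ⟨rfl, rfl⟩ | ⟨rfl, rfl⟩
          · exact this
          · exact this.symm
    rw [← hMk, this]
    symm
    apply Set.InjOn.ncard_image
    intro x hx y hy h
    rcases Sym2.eq_iff.mp h with ⟨h1, _⟩ | ⟨h1, _⟩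
    · exact h1
    · exact (hd x hx.1 (h1 ▸ hXadj y _ hy.1 (hm y hy.2).adj_sub)).elim
  have hXS := Set.ncard_sdiff_add_ncard_of_subset (s := S) (t := X) Set.inter_subset_left
  obtain ⟨f, hf, hfr⟩ := hall_set (fun a v => G.Adj a v ∧ v ∉ M.verts) (X \ S) (by
    intro T hT
    rcases T.eq_empty_or_nonempty with rfl | hne
    · simp
    have h0 := Set.ncard_le_ncard hT
    have h1 := hall T (hT.trans Set.sdiff_subset) ((Set.ncard_pos).mpr hne) (by omega)
    have h2 : G.setNeighborhood T ⊆ {v | ∃ a ∈ T, G.Adj a v ∧ v ∉ M.verts} ∪ m '' S := by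
      rintro v ⟨a, ha, h⟩
      by_cases hv : v ∈ M.verts
      · right
        have hvm := hm v hv
        refine ⟨m v, ⟨?_, hvm.snd_mem⟩, ?_⟩
        · have hvY := hXadj a v (hT ha).1 h
          rcases hbip _ _ hvm.adj_sub with h' | h'
          · exact (hd v h'.1 hvY).elim
          · exact h'.2
        · exact hM.eq_of_adj_left (hm _ hvm.snd_mem) hvm.symm
      · exact Or.inl ⟨a, ha, h, hv⟩
    have h3 := Set.ncard_le_ncard h2
    have h4 := Set.ncard_union_le {v | ∃ a ∈ T, G.Adj a v ∧ v ∉ M.verts} (m '' S)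
    have h5 := Set.ncard_image_le (f := m) (s := S)
    omega)
  set h : V → V := fun x => if x ∈ S then m x else f x with hh
  have h_pos : ∀ x ∈ S, h x = m x := fun x hx => if_pos hx
  have h_neg : ∀ x, x ∉ S → h x = f x := fun x hx => if_neg hx
  have hadj : ∀ x ∈ X, G.Adj x (h x) := by
    intro x hx
    by_cases hxS : x ∈ S
    · rw [h_pos x hxS]; exact (hm x hxS.2).adj_sub
    · rw [h_neg x hxS]; exact (hfr x ⟨hx, hxS⟩).1
  have hinj : Set.InjOn h X := by
    intro x hx y hy hxy
    by_cases h1 : x ∈ S <;> by_cases h2 : y ∈ S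
    · rw [h_pos x h1, h_pos y h2] at hxy
      have h3 := hm x h1.2
      rw [hxy] at h3
      exact hM.eq_of_adj_right h3 (hm y h2.2)
    · rw [h_pos x h1, h_neg y h2] at hxy
      exact ((hfr y ⟨hy, h2⟩).2 (hxy ▸ (hm x h1.2).snd_mem)).elim
    · rw [h_neg x h1, h_pos y h2] at hxy
      exact ((hfr x ⟨hx, h1⟩).2 (hxy ▸ (hm y h2.2).snd_mem)).elim
    · rw [h_neg x h1, h_neg y h2] at hxy
      exact hf ⟨hx, h1⟩ ⟨hy, h2⟩ hxy
  obtain ⟨P, hP, -, hPv, hPa⟩ := mk_matching G X Y hdisj hbip X subset_rfl h hinj hadj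
  have himg : h '' X = Y := by
    refine Set.eq_of_subset_of_ncard_le ?_ ?_ (Set.toFinite _)
    · rintro _ ⟨x, hx, rfl⟩
      exact hXadj x _ hx (hadj x hx)
    · rw [hinj.ncard_image, hXY]
  have huniv : P.verts = Set.univ := by rw [hPv, himg, hcover]
  refine ⟨P, ⟨hP, SimpleGraph.Subgraph.isSpanning_iff.mpr huniv⟩, ?_, ?_⟩
  · rw [huniv]; exact Set.subset_univ _
  · have key : ∀ u v, u ∈ X → M.Adj u v → P.Adj u v := by
      intro u v hu huv
      have h1 := hPa u hu
      rw [h_pos u ⟨hu, huv.fst_mem⟩, hM.eq_of_adj_left (hm u huv.fst_mem) huv] at h1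
      exact h1
    intro u v huv
    rcases hbip _ _ huv.adj_sub with h' | h'
    · exact key u v h'.1 huv
    · exact (key v u h'.2 huv.symm).symm

/-- A connected bipartite graph with a perfect matching and at least `2k+2` vertices
is `k`-extendible iff every `A ⊆ X` with `1 ≤ |A| ≤ |X| - k` has `|N(A)| ≥ |A| + k`. -/
theorem kExtendible_iff_bipartite_hall {V : Type*} [Fintype V]
    (G : SimpleGraph V) (k : ℕ) (X Y : Set V)
    (hcover : X ∪ Y = Set.univ) (hdisj : Disjoint X Y)
    (hbip : ∀ u v : V, G.Adj u v → (u ∈ X ∧ v ∈ Y) ∨ (u ∈ Y ∧ v ∈ X))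
    (hconn : G.Connected) (hpm : ∃ P : G.Subgraph, P.IsPerfectMatching)
    (hcard : 2 * k + 2 ≤ Fintype.card V) :
    G.IsKExtendible k ↔
      ∀ A : Set V, A ⊆ X → 1 ≤ A.ncard → A.ncard + k ≤ X.ncard →
        A.ncard + k ≤ (G.setNeighborhood A).ncard := by
  obtain ⟨P, hP⟩ := hpm
  obtain ⟨p, hp, hpP⟩ := pm_fun G P hP
  obtain ⟨hXY, hXc⟩ := card_XY G X Y hcover hdisj hbip p hp (fun v => (hpP v).adj_sub)
  constructor
  · intro hk A hA hA1 hAk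
    exact ext_imp_hall G k X Y hcover hdisj hbip hk (by omega) hXY A hA hA1 hAk
  · intro hall
    refine ⟨by rwa [Nat.card_eq_fintype_card], hconn, ⟨P, hP⟩, fun M hM hMk => ?_⟩
    exact hall_imp_ext G k X Y hcover hdisj hbip hXY hall M hM hMk
end

section
/- Let G be a connected bipartite graph with bipartition (X,Y) that has a perfect matching and at least 4 vertices. If G is 1-extendible (i.e., every edge of G lies in some perfect matching), then for every subset A ⊆ X with 1 ≤ |A| ≤ |X| - 1, the neighborhood of A in G satisfies |N(A)| ≥ |A| + 1. -/
/-- In a connected bipartite graph with a perfect matching, at least 4 vertices, and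
in which every edge lies in a perfect matching (1-extendibility), every `A ⊆ X` with
`1 ≤ |A| ≤ |X| - 1` satisfies `|N(A)| ≥ |A| + 1`. -/
theorem oneExtendible_bipartite_hall {V : Type*} [Fintype V]
    (G : SimpleGraph V) (X Y : Set V)
    (hcover : X ∪ Y = Set.univ) (hdisj : Disjoint X Y)
    (hbip : ∀ u v : V, G.Adj u v → (u ∈ X ∧ v ∈ Y) ∨ (u ∈ Y ∧ v ∈ X))
    (hconn : G.Connected) (hpm : ∃ P : G.Subgraph, P.IsPerfectMatching)
    (hcard : 4 ≤ Fintype.card V)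
    (hext : ∀ u v : V, G.Adj u v →
      ∃ P : G.Subgraph, P.IsPerfectMatching ∧ P.Adj u v) :
    ∀ A : Set V, A ⊆ X → 1 ≤ A.ncard → A.ncard + 1 ≤ X.ncard →
      A.ncard + 1 ≤ (G.setNeighborhood A).ncard := by
  intro A hA h1 h2
  have hNY : ∀ v ∈ G.setNeighborhood A, v ∉ X := by
    rintro v ⟨a, ha, hav⟩ hv
    rcases hbip a v hav with h | h
    · exact Set.disjoint_left.mp hdisj hv h.2
    · exact Set.disjoint_left.mp hdisj (hA ha) h.1
  obtain ⟨a, ha⟩ : A.Nonempty := Set.nonempty_of_ncard_ne_zero (by omega)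
  obtain ⟨x, hx, hxA⟩ : ∃ x ∈ X, x ∉ A :=
    Set.exists_mem_notMem_of_ncard_lt_ncard (by omega) (Set.toFinite A)
  obtain ⟨p⟩ := hconn.preconnected a x
  obtain ⟨d, -, hd1, hd2⟩ := p.exists_boundary_dart (A ∪ G.setNeighborhood A) (Or.inl ha)
    (by rintro (h | h)
        · exact hxA h
        · exact hNY x h hx)
  have hadj : G.Adj d.fst d.snd := d.adj
  have hfN : d.fst ∈ G.setNeighborhood A := by
    rcases hd1 with h | h
    · exact absurd (Or.inr ⟨_, h, hadj⟩) hd2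
    · exact h
  have hsA : d.snd ∉ A := fun h => hd2 (Or.inl h)
  obtain ⟨P, hP, hPd⟩ := hext _ _ hadj
  have hP' := SimpleGraph.Subgraph.isPerfectMatching_iff.mp hP
  choose f hf using fun v => (hP' v).exists
  have hinj : Set.InjOn f A := fun u _ v _ huv =>
    hP.1.eq_of_adj_right (hf u) (huv ▸ hf v)
  have hsub : f '' A ⊆ G.setNeighborhood A \ {d.fst} := by
    rintro _ ⟨u, hu, rfl⟩
    refine ⟨⟨u, hu, (hf u).adj_sub⟩, fun h => hsA ?_⟩
    have h3 := hf u
    rw [Set.mem_singleton_iff.mp h] at h3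
    rw [hP.1.eq_of_adj_left hPd h3.symm]
    exact hu
  have h4 := Set.ncard_le_ncard hsub (Set.toFinite _)
  rw [Set.ncard_image_of_injOn hinj] at h4
  have h5 := Set.ncard_diff_singleton_add_one hfN (Set.toFinite _)
  omega
end
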